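/- Let k ≥ 1 be an integer and let P ∈ ℝ[x₀,x₁,x₂] be a nonzero homogeneous polynomial of degree 2k, squarefree over ℂ, such that every singular point of the complex curve C = {P = 0} ⊂ ℙ²(ℂ) is a node, and let δ be the total number of singular points of C in ℙ²(ℂ). If ℝZ(P) is finite, then |ℝZ(P)| ≤ k² + ((2k−1)(k−1) − δ) + 1. (This is the bound |ℝC| ≤ k² + g(C) + 1 for a finite real plane curve of degree 2k, written for nodal curves, whose geometric genus is g = (2k−1)(k−1) − δ.) -/

import Mathlib

open MvPolynomial

/-- The real projective zero set of a homogeneous polynomial in three variables. -/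
noncomputable def RZ (P : MvPolynomial (Fin 3) ℝ) : Set (Projectivization ℝ (Fin 3 → ℝ)) :=
  {x | MvPolynomial.eval x.rep P = 0}

/-- The set of singular points of the plane curve `{Q = 0} ⊂ ℙ²(ℂ)`: points at which all
three partial derivatives of `Q` vanish. -/
noncomputable def SingSet (Q : MvPolynomial (Fin 3) ℂ) :
    Set (Projectivization ℂ (Fin 3 → ℂ)) :=
  {x | ∀ i : Fin 3, MvPolynomial.eval x.rep (pderiv i Q) = 0}

/-- The point `x` is a node of the curve `{Q = 0}`: the complex Hessian matrix of `Q`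
at (a representative of) `x` has rank `2`. -/
noncomputable def IsNodeAt (Q : MvPolynomial (Fin 3) ℂ)
    (x : Projectivization ℂ (Fin 3 → ℂ)) : Prop :=
  (Matrix.of fun i j : Fin 3 =>
    MvPolynomial.eval x.rep (pderiv i (pderiv j Q))).rank = 2


section

namespace FC

abbrev R2 := MvPolynomial (Fin 2) ℂ

/-- substitution `x ↦ t Y`, `y ↦ Y` : the coefficient of `Y^d` is the dehomogenised degree `d` part -/
noncomputable def Psi : R2 →ₐ[ℂ] Polynomial (Polynomial ℂ) :=
  MvPolynomial.aeval ![Polynomial.C Polynomial.X * Polynomial.X, Polynomial.X]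

noncomputable def T (d : ℕ) : R2 →ₗ[ℂ] Polynomial ℂ :=
  ((Polynomial.lcoeff (Polynomial ℂ) d).restrictScalars ℂ).comp Psi.toLinearMap

theorem T_apply (d : ℕ) (g : R2) : T d g = (Psi g).coeff d := rfl

noncomputable def mon (i j : ℕ) : Fin 2 →₀ ℕ := Finsupp.equivFunOnFinite.symm ![i, j]

theorem T_monomial (d : ℕ) (s : Fin 2 →₀ ℕ) (c : ℂ) :
    T d (monomial s c) = if d = s 0 + s 1 then Polynomial.monomial (s 0) c else 0 := by
  rw [T_apply, Psi, aeval_monomial, Finsupp.prod_fintype _ _ (by simp)]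
  simp only [Fin.prod_univ_two, Matrix.cons_val_zero, Matrix.cons_val_one, mul_pow]
  have : (algebraMap ℂ (Polynomial (Polynomial ℂ))) c = Polynomial.C (Polynomial.C c) := rfl
  rw [this, mul_assoc, ← pow_add, ← mul_assoc, ← Polynomial.C_pow, ← Polynomial.C_mul,
    Polynomial.coeff_C_mul_X_pow, Polynomial.C_mul_X_pow_eq_monomial]

theorem coeff_T (d j : ℕ) (g : R2) :
    (T d g).coeff j = if j ≤ d then g.coeff (mon j (d - j)) else 0 := by
  induction g using MvPolynomial.induction_on' with
  | monomial s c =>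
    rw [T_monomial, coeff_monomial]
    have e : s = mon j (d - j) ↔ s 0 = j ∧ s 1 = d - j := by
      constructor
      · rintro rfl; simp [mon]
      · rintro ⟨h0, h1⟩; ext i; fin_cases i <;> simp [mon, h0, h1]
    simp only [e]
    split_ifs with h1 h2 h3 h4 h5 <;> simp only [Polynomial.coeff_monomial, Polynomial.coeff_zero]
    · simp [h3.1]
    · rw [if_neg]; omega
    · rw [if_neg]; omega
    · omega
  | add p q hp hq =>
    rw [map_add, Polynomial.coeff_add, hp, hq]; split_ifs <;> simp

theorem natDegree_T (d : ℕ) (g : R2) : (T d g).natDegree ≤ d := by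
  rw [Polynomial.natDegree_le_iff_coeff_eq_zero]
  intro N hN
  rw [coeff_T, if_neg (by omega)]

theorem ext_T {g : R2} (h : ∀ d, T d g = 0) : g = 0 := by
  ext s
  have := congrArg (fun p => p.coeff (s 0)) (h (s 0 + s 1))
  simp only [coeff_T, Polynomial.coeff_zero] at this
  rw [if_pos (by omega)] at this
  have e : mon (s 0) (s 0 + s 1 - s 0) = s := by
    ext i; fin_cases i <;> simp [mon]
  rw [e] at this
  simpa using this

theorem Psi_inj : Function.Injective Psi := by
  rw [injective_iff_map_eq_zero]
  intro g hg
  apply ext_T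
  intro d
  rw [T_apply, hg]; simp

/-- polynomials of total degree `< d` -/
noncomputable def RL (d : ℕ) : Submodule ℂ R2 :=
  Submodule.comap Psi.toLinearMap ((Polynomial.degreeLT (Polynomial ℂ) d).restrictScalars ℂ)

theorem mem_RL {d : ℕ} {g : R2} : g ∈ RL d ↔ ∀ i, d ≤ i → T i g = 0 := by
  unfold RL
  rw [Submodule.mem_comap, Submodule.restrictScalars_mem, Polynomial.mem_degreeLT,
    Polynomial.degree_lt_iff_coeff_zero]
  rfl

theorem mem_RL_deg {d : ℕ} {g : R2} : g ∈ RL d ↔ (Psi g).degree < d := by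
  unfold RL
  rw [Submodule.mem_comap, Submodule.restrictScalars_mem, Polynomial.mem_degreeLT]
  rfl

theorem mem_RL_succ {d : ℕ} {g : R2} : g ∈ RL (d + 1) ↔ (Psi g).natDegree ≤ d := by
  rw [mem_RL, Polynomial.natDegree_le_iff_coeff_eq_zero]; rfl

theorem RL_mono {d e : ℕ} (h : d ≤ e) : RL d ≤ RL e := fun g hg =>
  mem_RL.2 fun i hi => mem_RL.1 hg i (h.trans hi)

theorem RL_zero {g : R2} (h : g ∈ RL 0) : g = 0 := ext_T fun d => mem_RL.1 h d (Nat.zero_le _)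

theorem RL_of_succ {d : ℕ} {g : R2} (h : g ∈ RL (d + 1)) (h0 : T d g = 0) : g ∈ RL d := by
  rw [mem_RL] at *
  intro i hi
  rcases hi.eq_or_lt with rfl | hi
  · exact h0
  · exact h i hi

theorem exists_RL (g : R2) : ∃ d, g ∈ RL d :=
  ⟨(Psi g).natDegree + 1, mem_RL_succ.2 le_rfl⟩

theorem mul_mem_RL {d e : ℕ} {g h : R2} (hg : g ∈ RL (d + 1)) (hh : h ∈ RL (e + 1)) :
    g * h ∈ RL (d + e + 1) := by
  rw [mem_RL_succ] at *
  rw [map_mul]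
  exact Polynomial.natDegree_mul_le_of_le hg hh

theorem mul_mem_RL' {d e : ℕ} {g h : R2} (hg : g ∈ RL d) (hh : h ∈ RL (e + 1)) :
    g * h ∈ RL (d + e) := by
  rcases d with _ | d
  · rw [RL_zero hg, zero_mul]; exact Submodule.zero_mem _
  · have := mul_mem_RL hg hh
    convert this using 2; omega

theorem T_mul {d e : ℕ} {g h : R2} (hg : g ∈ RL (d + 1)) (hh : h ∈ RL (e + 1)) :
    T (d + e) (g * h) = T d g * T e h := by
  rw [mem_RL_succ] at *
  rw [T_apply, map_mul]
  exact Polynomial.coeff_mul_add_eq_of_natDegree_le hg hh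

/-- the homogeneous lift -/
theorem exists_lift (d : ℕ) (τ : Polynomial ℂ) (h : τ.natDegree ≤ d) :
    ∃ g ∈ RL (d + 1), T d g = τ := by
  refine ⟨∑ i ∈ Finset.range (d + 1), monomial (mon i (d - i)) (τ.coeff i), ?_, ?_⟩
  · rw [mem_RL]
    intro j hj
    rw [map_sum]
    apply Finset.sum_eq_zero
    intro i hi
    rw [T_monomial, if_neg]
    simp at hi
    simp [mon]; omega
  · rw [map_sum]
    conv_rhs => rw [Polynomial.as_sum_range' τ (d + 1) (by omega)]
    apply Finset.sum_congr rfl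
    intro i hi
    simp at hi
    rw [T_monomial, if_pos]
    · simp [mon]
    · simp [mon]; omega

theorem RL_zero_eq : RL 0 = ⊥ := by
  rw [eq_bot_iff]; intro g hg; simpa using RL_zero hg

theorem RL_fin (d : ℕ) : FiniteDimensional ℂ (RL d) ∧ Module.finrank ℂ (RL d) = d * (d + 1) / 2 := by
  induction d with
  | zero => rw [RL_zero_eq]; exact ⟨inferInstance, by simp⟩
  | succ d ih =>
    obtain ⟨ih1, ih2⟩ := ih
    let F : RL (d + 1) →ₗ[ℂ] Polynomial.degreeLT ℂ (d + 1) :=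
      ((T d).comp (RL (d + 1)).subtype).codRestrict (Polynomial.degreeLT ℂ (d+1)) (by
        intro c
        rw [Polynomial.mem_degreeLT]
        have := natDegree_T d (c : R2)
        exact (Polynomial.degree_le_of_natDegree_le this).trans_lt (by exact_mod_cast Nat.lt_succ_self d))
    have hs : Function.Surjective F := by
      rintro ⟨τ, hτ⟩
      rw [Polynomial.mem_degreeLT] at hτ
      obtain ⟨g, hg, hT⟩ := exists_lift d τ (by
        by_cases h0 : τ = 0
        · simp [h0]
        · have := (Polynomial.natDegree_lt_iff_degree_lt h0).2 hτ
          omega)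
      exact ⟨⟨g, hg⟩, Subtype.ext hT⟩
    have hk : LinearMap.ker F = (RL d).submoduleOf (RL (d + 1)) := by
      ext ⟨g, hg⟩
      rw [LinearMap.mem_ker, Submodule.submoduleOf, Submodule.mem_comap]
      constructor
      · intro h
        exact RL_of_succ hg (congrArg Subtype.val h)
      · intro h
        exact Subtype.ext (mem_RL.1 h d le_rfl)
    have e := Submodule.submoduleOfEquivOfLe (RL_mono (Nat.le_succ d))
    have : FiniteDimensional ℂ (LinearMap.ker F) := by
      rw [hk]; exact Module.Finite.equiv e.symm
    have : FiniteDimensional ℂ (Polynomial.degreeLT ℂ (d + 1)) :=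
      Module.Finite.equiv (Polynomial.degreeLTEquiv ℂ (d + 1)).symm
    have : FiniteDimensional ℂ (RL (d + 1)) :=
      Module.Finite.of_surjective (M := (LinearMap.ker F) × (Polynomial.degreeLT ℂ (d + 1)))
        (((LinearMap.ker F).subtype).coprod (Classical.choose (F.exists_rightInverse_of_surjective
          (LinearMap.range_eq_top.2 hs)))) (by
          intro x
          have hh := Classical.choose_spec (F.exists_rightInverse_of_surjective
            (LinearMap.range_eq_top.2 hs))
          set G := Classical.choose (F.exists_rightInverse_of_surjective
            (LinearMap.range_eq_top.2 hs))
          refine ⟨(⟨x - G (F x), ?_⟩, F x), ?_⟩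
          · rw [LinearMap.mem_ker, map_sub]
            have := LinearMap.congr_fun hh (F x)
            simp only [LinearMap.comp_apply, LinearMap.id_apply] at this
            rw [this, sub_self]
          · simp)
    refine ⟨this, ?_⟩
    have h1 := LinearMap.finrank_range_add_finrank_ker F
    rw [LinearMap.range_eq_top.2 hs, finrank_top, hk, e.finrank_eq, ih2,
      (Polynomial.degreeLTEquiv ℂ (d + 1)).finrank_eq] at h1
    simp only [Module.finrank_fintype_fun_eq_card, Fintype.card_fin] at h1
    rw [← h1]
    have : (d + 1) * (d + 1 + 1) = d * (d + 1) + (d + 1) * 2 := by ring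
    rw [this, Nat.add_mul_div_right _ _ (by norm_num)]
    omega

instance (d : ℕ) : FiniteDimensional ℂ (RL d) := (RL_fin d).1

/-- syzygy lemma -/
theorem syz {n : ℕ} {a b : R2} (ha : a ∈ RL (n + 1)) (hb : b ∈ RL (n + 1))
    (hcop : IsCoprime (T n a) (T n b)) (hdeg : (T n a).natDegree = n) (hne : T n a ≠ 0) (t : ℕ) :
    ∀ e, ∀ u ∈ RL e, ∀ v ∈ RL e, a * u + b * v ∈ RL (t + n) →
      ∃ c, u - c * b ∈ RL t ∧ v + c * a ∈ RL t := by
  intro e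
  induction e with
  | zero =>
    intro u hu v hv _
    exact ⟨0, by simpa using RL_mono (Nat.zero_le t) hu, by simpa using RL_mono (Nat.zero_le t) hv⟩
  | succ e ih =>
    intro u hu v hv h
    by_cases het : e + 1 ≤ t
    · exact ⟨0, by simpa using RL_mono het hu, by simpa using RL_mono het hv⟩
    have h0 : T n a * T e u + T n b * T e v = 0 := by
      rw [← T_mul ha hu, ← T_mul hb hv, ← map_add]
      exact mem_RL.1 h _ (by omega)
    have hd : T n a ∣ T e v := by
      apply hcop.dvd_of_dvd_mul_left
      exact ⟨- T e u, by linear_combination h0⟩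
    obtain ⟨c0, hc0⟩ := hd
    have hU : T e u = - c0 * T n b := by
      apply mul_left_cancel₀ hne
      rw [hc0] at h0
      linear_combination h0
    by_cases hz : c0 = 0
    · subst hz
      simp only [mul_zero, neg_zero, zero_mul] at hc0 hU
      exact ih u (RL_of_succ hu hU) v (RL_of_succ hv hc0) h
    have hdd : n + c0.natDegree ≤ e := by
      have := natDegree_T e v
      rwa [hc0, Polynomial.natDegree_mul hne hz, hdeg] at this
    obtain ⟨c, hc, hcT⟩ := exists_lift (e - n) c0 (by omega)
    have hen : e - n + n = e := by omega
    have hcb : c * b ∈ RL (e + 1) := by simpa [hen] using mul_mem_RL hc hb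
    have hca : c * a ∈ RL (e + 1) := by simpa [hen] using mul_mem_RL hc ha
    have hcbT : T e (c * b) = c0 * T n b := by
      have := T_mul hc hb; rwa [hen, hcT] at this
    have hcaT : T e (c * a) = c0 * T n a := by
      have := T_mul hc ha; rwa [hen, hcT] at this
    obtain ⟨c', h1, h2⟩ := ih (u + c * b)
      (RL_of_succ (Submodule.add_mem _ hu hcb) (by rw [map_add, hcbT, hU]; ring)) (v - c * a)
      (RL_of_succ (Submodule.sub_mem _ hv hca) (by rw [map_sub, hcaT, hc0]; ring)) (by
        convert h using 1; ring)
    exact ⟨c' - c, by convert h1 using 1; ring, by convert h2 using 1; ring⟩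

theorem syz' {n : ℕ} {a b : R2} (ha : a ∈ RL (n + 1)) (hb : b ∈ RL (n + 1))
    (hcop : IsCoprime (T n a) (T n b)) (hdeg : (T n a).natDegree = n) (hne : T n a ≠ 0) (t : ℕ)
    (u v : R2) (h : a * u + b * v ∈ RL (t + n)) :
      ∃ c, u - c * b ∈ RL t ∧ v + c * a ∈ RL t := by
  obtain ⟨d, hd⟩ := exists_RL u
  obtain ⟨e, he⟩ := exists_RL v
  exact syz ha hb hcop hdeg hne t (max d e) u (RL_mono (le_max_left _ _) hd) v
    (RL_mono (le_max_right _ _) he) h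

theorem ideal_RL {n : ℕ} {a b : R2} (ha : a ∈ RL (n + 1)) (hb : b ∈ RL (n + 1))
    (hcop : IsCoprime (T n a) (T n b)) (hdeg : (T n a).natDegree = n) (hne : T n a ≠ 0) (t : ℕ)
    (x : R2) (hx : x ∈ Ideal.span {a, b}) (hx' : x ∈ RL (t + n)) :
    ∃ u ∈ RL t, ∃ v ∈ RL t, x = a * u + b * v := by
  obtain ⟨u, v, rfl⟩ := Ideal.mem_span_pair.1 hx
  obtain ⟨c, h1, h2⟩ := syz' ha hb hcop hdeg hne t u v (by convert hx' using 1; ring)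
  exact ⟨_, h1, _, h2, by ring⟩

theorem ideal_RL_zero {n : ℕ} {a b : R2} (ha : a ∈ RL (n + 1)) (hb : b ∈ RL (n + 1))
    (hcop : IsCoprime (T n a) (T n b)) (hdeg : (T n a).natDegree = n) (hne : T n a ≠ 0)
    (x : R2) (hx : x ∈ Ideal.span {a, b}) (hx' : x ∈ RL n) : x = 0 := by
  obtain ⟨u, hu, v, hv, rfl⟩ := ideal_RL ha hb hcop hdeg hne 0 x hx (by simpa using hx')
  rw [RL_zero hu, RL_zero hv]; simp

end FC

end


section
namespace FC

section quot

theorem mem_of_mul_mem {n : ℕ} {a b : R2} (ha : a ∈ RL (n + 1)) (hb : b ∈ RL (n + 1))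
    (hcop : IsCoprime (T n a) (T n b)) (hdeg : (T n a).natDegree = n) (hne : T n a ≠ 0)
    {t : ℕ} {c : R2} (h : c * a ∈ RL (t + n)) : c ∈ RL t := by
  by_cases hc : c = 0
  · rw [hc]; exact Submodule.zero_mem _
  have hpc : Psi c ≠ 0 := fun h0 => hc (Psi_inj (by rw [h0, map_zero]))
  have hpa : Psi a ≠ 0 := fun h0 => hne (by rw [T_apply, h0]; simp)
  have hn : (Psi a).natDegree = n := le_antisymm (mem_RL_succ.1 ha)
    (Polynomial.le_natDegree_of_ne_zero hne)
  rw [mem_RL_deg] at *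
  rw [map_mul, Polynomial.degree_mul, Polynomial.degree_eq_natDegree hpa, hn,
    Polynomial.degree_eq_natDegree hpc] at h
  rw [Polynomial.degree_eq_natDegree hpc]
  norm_cast at *
  omega

theorem finrank_image {n : ℕ} {a b : R2} (ha : a ∈ RL (n + 1)) (hb : b ∈ RL (n + 1))
    (hcop : IsCoprime (T n a) (T n b)) (hdeg : (T n a).natDegree = n) (hne : T n a ≠ 0)
    (t : ℕ) (ht : n ≤ t) :
    Module.finrank ℂ ((RL (t + n)).map (Ideal.Quotient.mkₐ ℂ (Ideal.span {a, b})).toLinearMap) ≤ n ^ 2 := by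
  set Q := (Ideal.Quotient.mkₐ ℂ (Ideal.span {a, b})).toLinearMap with hQ
  let q : RL (t + n) →ₗ[ℂ] (R2 ⧸ Ideal.span {a, b}) := Q.comp (RL (t + n)).subtype
  have hr : LinearMap.range q = (RL (t + n)).map Q := by
    rw [LinearMap.range_comp, Submodule.range_subtype]
  have hmem : ∀ x : RL t × RL t, a * (x.1 : R2) + b * (x.2 : R2) ∈ RL (t + n) := fun x =>
    Submodule.add_mem _ (by rw [mul_comm]; exact mul_mem_RL' x.1.2 ha)
      (by rw [mul_comm]; exact mul_mem_RL' x.2.2 hb)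
  let F : RL t × RL t →ₗ[ℂ] RL (t + n) := LinearMap.codRestrict (RL (t + n))
    (((LinearMap.mulLeft ℂ a).comp (RL t).subtype).coprod
      ((LinearMap.mulLeft ℂ b).comp (RL t).subtype)) (by
        intro x; simpa using hmem x)
  have hF : ∀ x, (F x : R2) = a * (x.1 : R2) + b * (x.2 : R2) := fun x => by simp [F]
  have hFq : LinearMap.range F ≤ LinearMap.ker q := by
    rintro _ ⟨x, rfl⟩
    rw [LinearMap.mem_ker]
    change Ideal.Quotient.mk (Ideal.span {a, b}) (F x : R2) = 0
    rw [hF, Ideal.Quotient.eq_zero_iff_mem]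
    exact Ideal.mem_span_pair.2 ⟨x.1, x.2, by ring⟩
  let G : RL (t - n) →ₗ[ℂ] RL t × RL t :=
    LinearMap.prod
      (LinearMap.codRestrict (RL t) ((LinearMap.mulLeft ℂ b).comp (RL (t - n)).subtype) (by
        intro x
        have := mul_mem_RL' x.2 hb
        rw [Nat.sub_add_cancel ht] at this
        simpa [mul_comm] using this))
      (LinearMap.codRestrict (RL t) (-(LinearMap.mulLeft ℂ a).comp (RL (t - n)).subtype) (by
        intro x
        have := mul_mem_RL' x.2 ha
        rw [Nat.sub_add_cancel ht] at this
        simpa [mul_comm] using this))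
  have hGF : LinearMap.ker F ≤ LinearMap.range G := by
    rintro ⟨⟨u, hu⟩, ⟨v, hv⟩⟩ hx
    have h0 : a * u + b * v = 0 := by
      have := congrArg Subtype.val (LinearMap.mem_ker.1 hx)
      rw [hF] at this
      simpa using this
    obtain ⟨c, h1, h2⟩ := syz' ha hb hcop hdeg hne 0 u v (by rw [h0]; exact Submodule.zero_mem _)
    have h1 := sub_eq_zero.1 (RL_zero h1)
    have h2 := eq_neg_of_add_eq_zero_left (RL_zero h2)
    have hc : c ∈ RL (t - n) := by
      apply mem_of_mul_mem ha hb hcop hdeg hne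
      rw [Nat.sub_add_cancel ht, ← neg_neg (c * a), ← h2]
      exact Submodule.neg_mem _ hv
    refine ⟨⟨c, hc⟩, ?_⟩
    apply Prod.ext
    · apply Subtype.ext; simp [G, h1, mul_comm]
    · apply Subtype.ext; simp [G, h2, mul_comm]
  have e1 := LinearMap.finrank_range_add_finrank_ker q
  have e2 := LinearMap.finrank_range_add_finrank_ker F
  have e3 := LinearMap.finrank_range_le G
  have e4 := Submodule.finrank_mono hFq
  have e5 := Submodule.finrank_mono hGF
  rw [hr] at e1
  rw [Module.finrank_prod] at e2
  rw [(RL_fin _).2] at e1 e2 e3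
  obtain ⟨s, rfl⟩ := Nat.exists_eq_add_of_le ht
  have hs : n + s - n = s := by omega
  replace e3 : Module.finrank ℂ (LinearMap.range G) ≤ s * (s + 1) / 2 := by
    refine e3.trans (le_of_eq ?_)
    rw [hs]
  have d1 : 2 ∣ (n + s + n) * (n + s + n + 1) := (Nat.even_mul_succ_self _).two_dvd
  have d2 : 2 ∣ (n + s) * (n + s + 1) := (Nat.even_mul_succ_self _).two_dvd
  have d3 : 2 ∣ s * (s + 1) := (Nat.even_mul_succ_self _).two_dvd
  obtain ⟨x1, hx1⟩ := d1
  obtain ⟨x2, hx2⟩ := d2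
  obtain ⟨x3, hx3⟩ := d3
  rw [hx1, Nat.mul_div_cancel_left _ (by norm_num)] at e1
  rw [hx2, Nat.mul_div_cancel_left _ (by norm_num)] at e2
  rw [hx3, Nat.mul_div_cancel_left _ (by norm_num)] at e3
  have key : x1 + x3 = n ^ 2 + 2 * x2 := by nlinarith
  omega

theorem quot_rank {n : ℕ} {a b : R2} (ha : a ∈ RL (n + 1)) (hb : b ∈ RL (n + 1))
    (hcop : IsCoprime (T n a) (T n b)) (hdeg : (T n a).natDegree = n) (hne : T n a ≠ 0)
    : Module.rank ℂ (R2 ⧸ Ideal.span {a, b}) ≤ (n ^ 2 : ℕ) := by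
  apply rank_le
  intro s hs
  choose g hg using fun x : R2 ⧸ Ideal.span {a, b} => Ideal.Quotient.mk_surjective x
  choose d hd using fun x : R2 => exists_RL x
  let t := n + s.sup (fun x => d (g x))
  have hsub : Submodule.span ℂ (s : Set (R2 ⧸ Ideal.span {a, b})) ≤
      (RL (t + n)).map (Ideal.Quotient.mkₐ ℂ (Ideal.span {a, b})).toLinearMap := by
    rw [Submodule.span_le]
    intro x hx
    refine ⟨g x, RL_mono ?_ (hd (g x)), hg x⟩
    have : d (g x) ≤ s.sup (fun x => d (g x)) := Finset.le_sup (f := fun x => d (g x)) hx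
    omega
  have h1 := finrank_span_finset_eq_card hs
  have : FiniteDimensional ℂ ((RL (t + n)).map (Ideal.Quotient.mkₐ ℂ (Ideal.span {a, b})).toLinearMap) :=
    inferInstance
  have h2 := Submodule.finrank_mono hsub
  have h3 := finrank_image ha hb hcop hdeg hne t (by omega)
  rw [← h1]
  exact h2.trans h3

theorem quot_fin {n : ℕ} {a b : R2} (ha : a ∈ RL (n + 1)) (hb : b ∈ RL (n + 1))
    (hcop : IsCoprime (T n a) (T n b)) (hdeg : (T n a).natDegree = n) (hne : T n a ≠ 0)
    : FiniteDimensional ℂ (R2 ⧸ Ideal.span {a, b}) ∧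
    Module.finrank ℂ (R2 ⧸ Ideal.span {a, b}) ≤ n ^ 2 := by
  have h := quot_rank ha hb hcop hdeg hne
  have : FiniteDimensional ℂ (R2 ⧸ Ideal.span {a, b}) :=
    Module.rank_lt_aleph0_iff.1 (h.trans_lt (Cardinal.natCast_lt_aleph0))
  refine ⟨this, ?_⟩
  rw [← Module.finrank_eq_rank] at h
  exact_mod_cast h

end quot

/-- linear algebra: nonnegative and nonpositive subspaces. -/
theorem semidef_null {V : Type*} [AddCommGroup V] [Module ℝ V] (β : V →ₗ[ℝ] V →ₗ[ℝ] ℝ)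
    (hsym : ∀ x y, β x y = β y x) (U : Submodule ℝ V) (hU : ∀ u ∈ U, 0 ≤ β u u)
    (v : V) (hv : v ∈ U) (hv0 : β v v = 0) (u : V) (hu : u ∈ U) : β v u = 0 := by
  by_contra hne
  have h := hU (u + (-(β u u + 1) / (2 * β v u)) • v)
    (U.add_mem hu (U.smul_mem _ hv))
  simp only [map_add, map_smul, LinearMap.add_apply, LinearMap.smul_apply, smul_eq_mul, hv0,
    hsym u v] at h
  have : (-(β u u + 1) / (2 * β v u)) * β v u = -(β u u + 1) / 2 := by field_simp
  nlinarith

theorem semidef_dim {V : Type*} [AddCommGroup V] [Module ℝ V] [FiniteDimensional ℝ V]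
    (β : V →ₗ[ℝ] V →ₗ[ℝ] ℝ)
    (hsym : ∀ x y, β x y = β y x) (U Z : Submodule ℝ V) (hU : ∀ u ∈ U, 0 ≤ β u u)
    (hZ : ∀ u ∈ Z, β u u ≤ 0) (hrad : ∀ z ∈ Z, (∀ v, β z v = 0) → z = 0) :
    Module.finrank ℝ U + Module.finrank ℝ Z ≤ Module.finrank ℝ V := by
  have hK : ∀ v ∈ U ⊓ Z, ∀ w ∈ U ⊔ Z, β v w = 0 := by
    rintro v ⟨hvU, hvZ⟩ w hw
    have h0 : β v v = 0 := le_antisymm (hZ v hvZ) (hU v hvU)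
    obtain ⟨x, hx, y, hy, rfl⟩ := Submodule.mem_sup.1 hw
    rw [map_add, semidef_null β hsym U hU v hvU h0 x hx]
    have := semidef_null (-β) (fun x y => by simp [hsym x y]) Z (fun u hu => by simpa using hZ u hu)
      v hvZ (by simp [h0]) y hy
    simp at this
    rw [this, add_zero]
  let F : (U ⊓ Z : Submodule ℝ V) →ₗ[ℝ] Module.Dual ℝ (V ⧸ (U ⊔ Z)) :=
    { toFun := fun v => (U ⊔ Z).liftQ (β v) (fun w hw => hK v v.2 w hw)
      map_add' := fun x y => by
        apply LinearMap.ext; intro w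
        obtain ⟨w, rfl⟩ := Submodule.Quotient.mk_surjective _ w
        change β (↑(x + y)) w = β x w + β y w
        simp
      map_smul' := fun c x => by
        apply LinearMap.ext; intro w
        obtain ⟨w, rfl⟩ := Submodule.Quotient.mk_surjective _ w
        change β (↑(c • x)) w = c * β x w
        simp }
  have hF : Function.Injective F := by
    rw [injective_iff_map_eq_zero]
    intro v hv
    apply Subtype.ext
    apply hrad v v.2.2
    intro w
    have := LinearMap.congr_fun hv (Submodule.Quotient.mk w)
    exact this
  have h1 := LinearMap.finrank_le_finrank_of_injective hF
  rw [Subspace.dual_finrank_eq] at h1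
  have h2 := Submodule.finrank_quotient_add_finrank (U ⊔ Z)
  have h3 := Submodule.finrank_sup_add_finrank_inf_eq U Z
  omega

/-- derivations -/
theorem T_pderiv_zero (d : ℕ) (g : R2) :
    T d (pderiv 0 g) = Polynomial.derivative (T (d + 1) g) := by
  induction g using MvPolynomial.induction_on' with
  | monomial s c =>
    rw [pderiv_monomial, T_monomial, T_monomial]
    simp only [Finsupp.coe_tsub, Pi.sub_apply, Finsupp.single_eq_same,
      Finsupp.single_eq_of_ne (show (1 : Fin 2) ≠ 0 by decide), Nat.sub_zero]
    by_cases h0 : s 0 = 0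
    · simp [h0]
      split_ifs <;> simp
    · have : (d = s 0 - 1 + s 1) ↔ (d + 1 = s 0 + s 1) := by omega
      simp only [this]
      split_ifs with h
      · rw [Polynomial.derivative_monomial]
      · simp
  | add p q hp hq => simp only [map_add, hp, hq]

theorem T_pderiv_one (d : ℕ) (g : R2) :
    T d (pderiv 1 g) = ((d + 1 : ℕ) : Polynomial ℂ) * (T (d + 1) g)
      - Polynomial.X * Polynomial.derivative (T (d + 1) g) := by
  induction g using MvPolynomial.induction_on' with
  | monomial s c =>
    rw [pderiv_monomial, T_monomial, T_monomial]
    simp only [Finsupp.coe_tsub, Pi.sub_apply, Finsupp.single_eq_same,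
      Finsupp.single_eq_of_ne (show (0 : Fin 2) ≠ 1 by decide), Nat.sub_zero]
    by_cases h0 : d + 1 = s 0 + s 1
    · rw [if_pos h0, h0, Polynomial.derivative_monomial]
      have hX : Polynomial.X * (Polynomial.monomial (s 0 - 1)) (c * (s 0 : ℂ))
          = (s 0 : Polynomial ℂ) * Polynomial.monomial (s 0) c := by
        rw [← Polynomial.C_mul_X_pow_eq_monomial, ← Polynomial.C_mul_X_pow_eq_monomial]
        rcases Nat.eq_zero_or_pos (s 0) with h | h
        · simp [h]
        · obtain ⟨m, hm⟩ := Nat.exists_eq_add_of_le' h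
          rw [hm]; simp; ring
      rw [hX]
      push_cast
      have hm : Polynomial.monomial (s 0) (c * (s 1 : ℂ))
          = (s 1 : Polynomial ℂ) * Polynomial.monomial (s 0) c := by
        rw [← Polynomial.C_mul_X_pow_eq_monomial, ← Polynomial.C_mul_X_pow_eq_monomial]
        simp; ring
      rcases Nat.eq_zero_or_pos (s 1) with h | h
      · simp [h]
      · rw [if_pos (by omega), hm]; ring
    · rw [if_neg h0]
      rcases Nat.eq_zero_or_pos (s 1) with h | h
      · simp [h]
      · rw [if_neg (by omega)]; simp
  | add p q hp hq => simp only [map_add, hp, hq]; ring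

theorem mem_RL_X0 (c : ℂ) : (X 0 - C c : R2) ∈ RL 2 ∧ T 1 (X 0 - C c : R2) = Polynomial.X := by
  have h : ∀ d, 1 ≤ d → T d (X 0 - C c : R2) = if d = 1 then Polynomial.X else 0 := by
    intro d hd
    rw [map_sub, X, C_apply, T_monomial, T_monomial]
    simp
    have : d ≠ 0 := by omega
    simp [this, Polynomial.X]
  exact ⟨mem_RL.2 fun i hi => by rw [h i (by omega), if_neg (by omega)], by rw [h 1 le_rfl, if_pos rfl]⟩

theorem mem_RL_X1 (c : ℂ) : (X 1 - C c : R2) ∈ RL 2 ∧ T 1 (X 1 - C c : R2) = 1 := by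
  have h : ∀ d, 1 ≤ d → T d (X 1 - C c : R2) = if d = 1 then 1 else 0 := by
    intro d hd
    rw [map_sub, X, C_apply, T_monomial, T_monomial]
    simp
    have : d ≠ 0 := by omega
    simp [this]
  exact ⟨mem_RL.2 fun i hi => by rw [h i (by omega), if_neg (by omega)], by rw [h 1 le_rfl, if_pos rfl]⟩

theorem taylor (p : Fin 2 → ℂ) (d : ℕ) : ∀ g ∈ RL (d + 1),
    ∃ g1 ∈ RL d, ∃ g2 ∈ RL d,
      g = g1 * (X 0 - C (p 0)) + g2 * (X 1 - C (p 1)) + C (eval p g) := by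
  induction d with
  | zero =>
    intro g hg
    refine ⟨0, Submodule.zero_mem _, 0, Submodule.zero_mem _, ?_⟩
    have h0 : g = C ((T 0 g).coeff 0) := by
      rw [← sub_eq_zero]
      apply RL_zero
      apply RL_of_succ
      · apply Submodule.sub_mem _ hg
        rw [mem_RL]; intro i hi
        rw [C_apply, T_monomial]; simp; omega
      · rw [map_sub, C_apply, T_monomial]
        simp
        have := Polynomial.eq_C_of_natDegree_le_zero (natDegree_T 0 g)
        rw [sub_eq_zero, this]; simp
    rw [h0]; simp
  | succ d ih =>
    intro g hg
    set τ := T (d + 1) g with hτ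
    have hτd : τ.natDegree ≤ d + 1 := natDegree_T _ _
    obtain ⟨u, hu, hu'⟩ := exists_lift d τ.divX (by rw [Polynomial.natDegree_divX_eq_natDegree_tsub_one]; omega)
    obtain ⟨v, hv, hv'⟩ := exists_lift d (Polynomial.C (τ.coeff 0)) (by simp)
    obtain ⟨h0, h0'⟩ := mem_RL_X0 (p 0)
    obtain ⟨h1, h1'⟩ := mem_RL_X1 (p 1)
    obtain ⟨g1, hg1, g2, hg2, hg⟩ := ih (g - u * (X 0 - C (p 0)) - v * (X 1 - C (p 1))) (by
      apply RL_of_succ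
      · exact Submodule.sub_mem _ (Submodule.sub_mem _ hg (mul_mem_RL hu h0)) (mul_mem_RL hv h1)
      · rw [map_sub, map_sub, T_mul hu h0, T_mul hv h1, hu', hv', h0', h1', ← hτ]
        linear_combination - Polynomial.divX_mul_X_add τ)
    refine ⟨g1 + u, Submodule.add_mem _ (RL_mono (Nat.le_succ d) hg1) hu, g2 + v,
      Submodule.add_mem _ (RL_mono (Nat.le_succ d) hg2) hv, ?_⟩
    simp only [map_sub, map_mul, eval_X, eval_C, sub_self, mul_zero, sub_zero] at hg
    linear_combination hg

end FC

end


section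
namespace FC

/-- coefficientwise complex conjugation -/
noncomputable def sg : R2 →+* R2 := MvPolynomial.map (starRingEnd ℂ)

/-- The data: `f` of degree `2 * k = m + 2`. -/
structure Dat (k m : ℕ) (f : R2) : Prop where
  hm : 2 * k = m + 2
  hf : f ∈ RL (m + 3)
  hnat : (T (m + 2) f).natDegree = m + 2
  hsep : (T (m + 2) f).Separable
  hreal : ∀ x : ℝ, (T (m + 2) f).eval (x : ℂ) ≠ 0
  hsg : sg f = f
  pos : ∀ x : Fin 2 → ℝ, ∃ y : ℝ, 0 ≤ y ∧ eval (fun i => (x i : ℂ)) f = y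
  node : ∀ q : Fin 2 → ℂ, eval q f = 0 → eval q (pderiv 0 f) = 0 → eval q (pderiv 1 f) = 0 →
    eval q (pderiv 0 (pderiv 0 f)) * eval q (pderiv 1 (pderiv 1 f))
      - eval q (pderiv 1 (pderiv 0 f)) * eval q (pderiv 0 (pderiv 1 f)) ≠ 0

/-- Lagrange formula -/
theorem lagrange (φ : Polynomial ℂ) (hs : φ.Separable) (n : ℕ) (hn : φ.natDegree = n + 1)
    (q : Polynomial ℂ) (hq : q.natDegree ≤ n) :
    ∑ z ∈ φ.roots.toFinset, q.eval z / (Polynomial.derivative φ).eval z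
      = q.coeff n / φ.leadingCoeff := by
  have hsplit : φ.Splits := IsAlgClosed.splits φ
  have hnd : φ.roots.Nodup := Polynomial.nodup_roots hs
  have hcard : φ.roots.toFinset.card = n + 1 := by
    rw [Multiset.toFinset_card_of_nodup hnd, ← hsplit.natDegree_eq_card_roots, hn]
  have hφ : φ = Polynomial.C φ.leadingCoeff * Lagrange.nodal φ.roots.toFinset id := by
    conv_lhs => rw [hsplit.eq_prod_roots]
    congr 1
    rw [Lagrange.nodal, Finset.prod, Multiset.toFinset_val, Multiset.dedup_eq_self.2 hnd]
    rfl
  have h1 := Lagrange.coeff_eq_sum (s := φ.roots.toFinset) (v := id) (F := ℂ)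
    (Set.injOn_id _) (P := q) (by
      rw [hcard]
      exact (Polynomial.degree_le_of_natDegree_le hq).trans_lt (by exact_mod_cast Nat.lt_succ_self n))
  rw [hcard, Nat.add_sub_cancel] at h1
  rw [h1, Finset.sum_div]
  apply Finset.sum_congr rfl
  intro z hz
  have : (Polynomial.derivative φ).eval z = φ.leadingCoeff * ∏ j ∈ φ.roots.toFinset.erase z, (z - j) := by
    conv_lhs => rw [hφ]
    rw [Polynomial.derivative_C_mul, Polynomial.eval_mul, Polynomial.eval_C]
    congr 1
    have := Lagrange.eval_nodal_derivative_eval_node_eq (v := id) hz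
    simp only [id] at this
    rw [this, Lagrange.eval_nodal]
    simp
  rw [this, div_div, mul_comm]
  simp

section
variable {k m : ℕ} {f : R2}

theorem Dat.ha (D : Dat k m f) : pderiv 0 f ∈ RL (m + 2) := by
  rw [mem_RL]; intro i hi
  rw [T_pderiv_zero, mem_RL.1 D.hf _ (by omega)]; simp

theorem Dat.hb (D : Dat k m f) : pderiv 1 f ∈ RL (m + 2) := by
  rw [mem_RL]; intro i hi
  rw [T_pderiv_one, mem_RL.1 D.hf _ (by omega)]; simp

theorem Dat.hTa (_ : Dat k m f) : T (m + 1) (pderiv 0 f) = Polynomial.derivative (T (m + 2) f) :=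
  T_pderiv_zero _ _

theorem Dat.hTb (_ : Dat k m f) : T (m + 1) (pderiv 1 f) =
    ((m + 2 : ℕ) : Polynomial ℂ) * T (m + 2) f - Polynomial.X * Polynomial.derivative (T (m + 2) f) :=
  T_pderiv_one _ _

theorem Dat.hcop (D : Dat k m f) : IsCoprime (T (m + 1) (pderiv 0 f)) (T (m + 1) (pderiv 1 f)) := by
  rw [D.hTa, D.hTb]
  obtain ⟨u, v, h⟩ := D.hsep
  have hC : (Polynomial.C ((m + 2 : ℕ) : ℂ)⁻¹) * ((m + 2 : ℕ) : Polynomial ℂ) = 1 := by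
    rw [← Polynomial.C_eq_natCast, ← Polynomial.C_mul, inv_mul_cancel₀, Polynomial.C_1]
    exact Nat.cast_ne_zero.2 (by omega)
  refine ⟨v + Polynomial.C ((m + 2 : ℕ) : ℂ)⁻¹ * u * Polynomial.X,
    Polynomial.C ((m + 2 : ℕ) : ℂ)⁻¹ * u, ?_⟩
  linear_combination h + (u * T (m + 2) f) * hC

theorem Dat.hdeg (D : Dat k m f) : (T (m + 1) (pderiv 0 f)).natDegree = m + 1 := by
  rw [D.hTa, Polynomial.natDegree_derivative, D.hnat]; rfl

theorem Dat.hne (D : Dat k m f) : T (m + 1) (pderiv 0 f) ≠ 0 := by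
  intro h
  have := D.hdeg
  rw [h] at this; simp at this

/-- roots at infinity -/
noncomputable def rts (m : ℕ) (f : R2) : Finset ℂ := (T (m + 2) f).roots.toFinset

theorem Dat.mem_rts (D : Dat k m f) (z : ℂ) : z ∈ rts m f ↔ (T (m + 2) f).eval z = 0 := by
  rw [rts, Multiset.mem_toFinset, Polynomial.mem_roots']
  refine ⟨fun h => h.2, fun h => ⟨?_, h⟩⟩
  intro h0
  have := D.hnat
  rw [h0] at this; simp at this

theorem Dat.dphi_ne (D : Dat k m f) {z : ℂ} (hz : z ∈ rts m f) :
    (Polynomial.derivative (T (m + 2) f)).eval z ≠ 0 := by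
  rw [D.mem_rts] at hz
  obtain ⟨u, v, h⟩ := D.hsep
  intro h0
  have := congrArg (Polynomial.eval z) h
  simp [hz, h0] at this

noncomputable def ell (m : ℕ) (f : R2) : R2 →ₗ[ℂ] ℂ :=
  -∑ z ∈ rts m f, (((Polynomial.derivative (T (m + 2) f)).eval z ^ 2)⁻¹) •
    ((Polynomial.leval z).comp (T (m + m)))

theorem ell_apply (g : R2) : ell m f g = -∑ z ∈ rts m f, (T (m + m) g).eval z /
    (Polynomial.derivative (T (m + 2) f)).eval z ^ 2 := by
  simp [ell, Polynomial.leval, div_eq_inv_mul]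

theorem Dat.ell_ideal (D : Dat k m f) (g : R2) (hg : g ∈ Ideal.span {pderiv 0 f, pderiv 1 f})
    (hg' : g ∈ RL (m + m + 1)) : ell m f g = 0 := by
  obtain ⟨u, hu, v, hv, rfl⟩ := ideal_RL D.ha D.hb D.hcop D.hdeg D.hne m g hg
    (by rwa [← add_assoc])
  rcases m with _ | m
  · rw [RL_zero hu, RL_zero hv]; simp
  have hT : T (m + 1 + (m + 1)) (pderiv 0 f * u + pderiv 1 f * v) =
      T (m + 2) (pderiv 0 f) * T m u + T (m + 2) (pderiv 1 f) * T m v := by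
    have e : m + 1 + (m + 1) = m + 2 + m := by omega
    rw [e, map_add, T_mul D.ha hu, T_mul D.hb hv]
  rw [ell_apply, hT]
  have hl := lagrange (T (m + 1 + 2) f) D.hsep (m + 2) D.hnat (T m u - Polynomial.X * T m v) (by
    refine (Polynomial.natDegree_sub_le _ _).trans (max_le ((natDegree_T m u).trans (by omega)) ?_)
    refine Polynomial.natDegree_mul_le.trans ?_
    have := natDegree_T m v
    have := Polynomial.natDegree_X_le (R := ℂ)
    omega)
  have h0 : (T m u - Polynomial.X * T m v).coeff (m + 2) = 0 := by
    have h1 := natDegree_T m u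
    have h2 := natDegree_T m v
    rw [Polynomial.coeff_sub, Polynomial.coeff_X_mul, Polynomial.coeff_eq_zero_of_natDegree_lt,
      Polynomial.coeff_eq_zero_of_natDegree_lt, sub_zero] <;> omega
  rw [h0, zero_div] at hl
  rw [neg_eq_zero, ← hl]
  apply Finset.sum_congr rfl
  intro z hz
  have hz1 := (D.mem_rts z).1 hz
  have hz2 := D.dphi_ne hz
  have hA := congrArg (Polynomial.eval z) D.hTa
  have hB := congrArg (Polynomial.eval z) D.hTb
  simp only [Polynomial.eval_sub, Polynomial.eval_mul, hz1, Polynomial.eval_X, mul_zero, zero_sub,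
    Polynomial.eval_add] at hA hB ⊢
  rw [hA, hB]
  field_simp
  ring

theorem Dat.exists_L (D : Dat k m f) :
    ∃ L : (R2 ⧸ Ideal.span {pderiv 0 f, pderiv 1 f}) →ₗ[ℂ] ℂ,
      ∀ g ∈ RL (m + m + 1), L (Ideal.Quotient.mk _ g) = ell m f g := by
  let q := (Ideal.Quotient.mkₐ ℂ (Ideal.span {pderiv 0 f, pderiv 1 f})).toLinearMap.comp
    (RL (m + m + 1)).subtype
  have h : (ell m f).comp (RL (m + m + 1)).subtype ∈ LinearMap.range q.dualMap := by
    rw [LinearMap.range_dualMap_eq_dualAnnihilator_ker, Submodule.mem_dualAnnihilator]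
    rintro ⟨g, hg⟩ hgk
    have h1 : Ideal.Quotient.mk (Ideal.span {pderiv 0 f, pderiv 1 f}) g = 0 := hgk
    exact D.ell_ideal g (Ideal.Quotient.eq_zero_iff_mem.1 h1) hg
  obtain ⟨L, hL⟩ := h
  exact ⟨L, fun g hg => LinearMap.congr_fun hL ⟨g, hg⟩⟩

/-- Bezoutian at a point -/
theorem Dat.bez (D : Dat k m f) (p : Fin 2 → ℂ) (h0 : eval p (pderiv 0 f) = 0)
    (h1 : eval p (pderiv 1 f) = 0) :
    ∃ E ∈ RL (m + m + 1), ell m f E = ((m + 2 : ℕ) : ℂ) ∧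
      eval p E = eval p (pderiv 0 (pderiv 0 f)) * eval p (pderiv 1 (pderiv 1 f))
      - eval p (pderiv 1 (pderiv 0 f)) * eval p (pderiv 0 (pderiv 1 f)) ∧
      ∀ g : R2, (g - C (eval p g)) * E ∈ Ideal.span {pderiv 0 f, pderiv 1 f} := by
  obtain ⟨a1, ha1, a2, ha2, ha⟩ := taylor p (m + 1) _ D.ha
  obtain ⟨b1, hb1, b2, hb2, hb⟩ := taylor p (m + 1) _ D.hb
  rw [h0, C_0, add_zero] at ha
  rw [h1, C_0, add_zero] at hb
  obtain ⟨x0, x0'⟩ := mem_RL_X0 (p 0)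
  obtain ⟨x1, x1'⟩ := mem_RL_X1 (p 1)
  refine ⟨a1 * b2 - a2 * b1, Submodule.sub_mem _ (mul_mem_RL ha1 hb2) (mul_mem_RL ha2 hb1), ?_, ?_, ?_⟩
  · have hTa : T (m + 1) (pderiv 0 f) = T m a1 * Polynomial.X + T m a2 := by
      rw [ha, map_add, T_mul ha1 x0, T_mul ha2 x1, x0', x1', mul_one]
    have hTb : T (m + 1) (pderiv 1 f) = T m b1 * Polynomial.X + T m b2 := by
      rw [hb, map_add, T_mul hb1 x0, T_mul hb2 x1, x0', x1', mul_one]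
    have d1 := natDegree_T m a1
    have d2 := natDegree_T m a2
    have d3 := natDegree_T m b1
    have hl := lagrange (T (m + 2) f) D.hsep (m + 1) D.hnat (T m a1 * Polynomial.X + T m b1) (by
      refine (Polynomial.natDegree_add_le _ _).trans (max_le ?_ (by omega))
      refine Polynomial.natDegree_mul_le.trans ?_
      have := Polynomial.natDegree_X_le (R := ℂ)
      omega)
    have hlc : (T m a1 * Polynomial.X + T m b1).coeff (m + 1) =
        (m + 2 : ℕ) * (T (m + 2) f).leadingCoeff := by
      have := congrArg (fun q => q.coeff (m + 1)) (D.hTa.symm.trans hTa)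
      simp only [Polynomial.coeff_derivative, Polynomial.coeff_add, Polynomial.coeff_mul_X] at this
      rw [Polynomial.coeff_eq_zero_of_natDegree_lt (show (T m a2).natDegree < m + 1 by omega)] at this
      rw [Polynomial.coeff_add, Polynomial.coeff_mul_X,
        Polynomial.coeff_eq_zero_of_natDegree_lt (show (T m b1).natDegree < m + 1 by omega), ← this,
        Polynomial.leadingCoeff, D.hnat]
      push_cast; ring
    have hlne : (T (m + 2) f).leadingCoeff ≠ 0 := by
      rw [Polynomial.leadingCoeff_ne_zero]
      intro h; have := D.hnat; rw [h] at this; simp at this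
    rw [hlc, mul_div_cancel_right₀ _ hlne] at hl
    rw [ell_apply, ← hl, ← Finset.sum_neg_distrib]
    apply Finset.sum_congr rfl
    intro z hz
    have hz1 := (D.mem_rts z).1 hz
    have hz2 := D.dphi_ne hz
    have hA := congrArg (Polynomial.eval z) (D.hTa.symm.trans hTa)
    have hB := congrArg (Polynomial.eval z) (D.hTb.symm.trans hTb)
    simp only [Polynomial.eval_sub, Polynomial.eval_mul, hz1, Polynomial.eval_X, mul_zero, zero_sub,
      Polynomial.eval_add] at hA hB
    rw [map_sub, T_mul ha1 hb2, T_mul ha2 hb1]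
    simp only [Polynomial.eval_sub, Polynomial.eval_mul, Polynomial.eval_X, Polynomial.eval_add]
    have hA2 := eq_sub_of_add_eq' hA.symm
    have hB2 := eq_sub_of_add_eq' hB.symm
    rw [hA2, hB2]
    field_simp
    ring
  · have e : ∀ (g g1 g2 : R2), g = g1 * (X 0 - C (p 0)) + g2 * (X 1 - C (p 1)) →
        eval p (pderiv 0 g) = eval p g1 ∧ eval p (pderiv 1 g) = eval p g2 := by
      rintro g g1 g2 rfl
      simp [pderiv_X_of_ne]
    obtain ⟨e1, e2⟩ := e _ _ _ ha
    obtain ⟨e3, e4⟩ := e _ _ _ hb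
    rw [e1, e2, e3, e4]; simp
  · intro g
    obtain ⟨d, hd⟩ := exists_RL g
    obtain ⟨g1, -, g2, -, hg⟩ := taylor p d g (RL_mono (Nat.le_succ d) hd)
    rw [Ideal.mem_span_pair]
    refine ⟨g1 * b2 - g2 * b1, g2 * a1 - g1 * a2, ?_⟩
    have hg' : g - C (eval p g) = g1 * (X 0 - C (p 0)) + g2 * (X 1 - C (p 1)) := by
      linear_combination hg
    rw [hg']
    linear_combination (g1 * b2 - g2 * b1) * ha + (g2 * a1 - g1 * a2) * hb

end
end FC

end


section
namespace FC

/-- conjugate point -/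
def cj (q : Fin 2 → ℂ) : Fin 2 → ℂ := fun i => starRingEnd ℂ (q i)

theorem cj_cj (q : Fin 2 → ℂ) : cj (cj q) = q := by
  funext i; simp [cj]

theorem sg_sg (g : R2) : sg (sg g) = g := by
  have : (starRingEnd ℂ).comp (starRingEnd ℂ) = RingHom.id ℂ := by
    ext x; simp
  rw [sg, MvPolynomial.map_map, this, MvPolynomial.map_id]; 

theorem sg_C (c : ℂ) : sg (C c) = C (starRingEnd ℂ c) := by simp [sg]

theorem eval_sg (q : Fin 2 → ℂ) (g : R2) : eval q (sg g) = starRingEnd ℂ (eval (cj q) g) := by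
  have : q = fun i => starRingEnd ℂ (cj q i) := by funext i; simp [cj]
  rw [sg, eval_map]
  conv_lhs => rw [this]
  induction g using MvPolynomial.induction_on with
  | C a => simp
  | add p q hp hq => simp only [map_add, eval₂_add, hp, hq]
  | mul_X p i hp => simp only [map_mul, eval₂_mul, hp, eval₂_X, eval_X]

theorem sg_pderiv (i : Fin 2) (g : R2) : sg (pderiv i g) = pderiv i (sg g) := by
  rw [sg, pderiv_map]

theorem T_sg (d : ℕ) (g : R2) : T d (sg g) = (T d g).map (starRingEnd ℂ) := by
  ext j
  rw [Polynomial.coeff_map, coeff_T, coeff_T, sg, coeff_map]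
  split_ifs <;> simp

theorem sg_RL {d : ℕ} {g : R2} (hg : g ∈ RL d) : sg g ∈ RL d := by
  rw [mem_RL] at *
  intro i hi
  rw [T_sg, hg i hi]; simp

/-- Jacobian ideal -/
noncomputable abbrev JI (f : R2) : Ideal R2 := Ideal.span {pderiv 0 f, pderiv 1 f}

/-- Jacobian ring -/
abbrev BB (f : R2) := R2 ⧸ JI f

/-- Crit -/
def Crit (f : R2) : Set (Fin 2 → ℂ) := {q | eval q (pderiv 0 f) = 0 ∧ eval q (pderiv 1 f) = 0}

/-- Nodes -/
def Nod (f : R2) : Set (Fin 2 → ℂ) := {q | eval q f = 0 ∧ q ∈ Crit f}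

/-- Hessian -/
noncomputable def Jac (f : R2) (q : Fin 2 → ℂ) : ℂ :=
  eval q (pderiv 0 (pderiv 0 f)) * eval q (pderiv 1 (pderiv 1 f))
      - eval q (pderiv 1 (pderiv 0 f)) * eval q (pderiv 0 (pderiv 1 f))

theorem JI_le_ker {f : R2} {q : Fin 2 → ℂ} (hq : q ∈ Crit f) {g : R2} (hg : g ∈ JI f) :
    eval q g = 0 := by
  obtain ⟨u, v, rfl⟩ := Ideal.mem_span_pair.1 hg
  simp [hq.1, hq.2]

theorem interp (S : Finset (Fin 2 → ℂ)) (v : (Fin 2 → ℂ) → ℂ) :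
    ∃ g : R2, ∀ q ∈ S, eval q g = v q := by
  classical
  induction S using Finset.induction_on with
  | empty => exact ⟨0, by simp⟩
  | insert p S hp ih =>
    obtain ⟨g, hg⟩ := ih
    have : ∀ q ∈ S, ∃ i, p i ≠ q i := by
      intro q hq
      by_contra! h
      exact hp (by rwa [show p = q from funext h])
    choose! i hi using this
    let N : R2 := ∏ q ∈ S, (X (i q) - C (q (i q)))
    have hN : eval p N ≠ 0 := by
      simp only [N, map_prod, map_sub, eval_X, eval_C]
      exact Finset.prod_ne_zero_iff.2 fun q hq => sub_ne_zero.2 (hi q hq)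
    have hN' : ∀ q ∈ S, eval q N = 0 := by
      intro q hq
      simp only [N, map_prod, map_sub, eval_X, eval_C]
      exact Finset.prod_eq_zero hq (sub_self _)
    refine ⟨g + C ((v p - eval p g) / eval p N) * N, ?_⟩
    intro q hq
    rcases Finset.mem_insert.1 hq with rfl | hq
    · simp; field_simp; ring
    · simp [hN' q hq, hg q hq]

section
variable {k m : ℕ} {f : R2}

theorem Dat.finB (D : Dat k m f) : FiniteDimensional ℂ (BB f) ∧
    Module.finrank ℂ (BB f) ≤ (m + 1) ^ 2 :=
  quot_fin D.ha D.hb D.hcop D.hdeg D.hne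

theorem Dat.crit_fin (D : Dat k m f) : (Crit f).Finite := by
  by_contra h
  obtain ⟨S, hS, hc⟩ := Set.Infinite.exists_subset_card_eq h ((m + 1) ^ 2 + 1)
  obtain ⟨h1, h2⟩ := D.finB
  let ev : BB f →ₗ[ℂ] (S → ℂ) := (Ideal.Quotient.liftₐ (JI f)
    (AlgHom.pi fun q : S => (MvPolynomial.aeval q.1 : R2 →ₐ[ℂ] ℂ)) (by
      intro g hg
      funext q
      have := JI_le_ker (hS q.2) hg
      simpa [aeval_eq_eval] using this)).toLinearMap
  have hsurj : Function.Surjective ev := by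
    intro v
    classical
    obtain ⟨g, hg⟩ := interp S (fun q => if hq : q ∈ S then v ⟨q, hq⟩ else 0)
    refine ⟨Ideal.Quotient.mk _ g, ?_⟩
    funext q
    have := hg q.1 q.2
    simp only [q.2, dif_pos] at this
    rw [← this]
    change aeval q.1 g = _
    rw [aeval_eq_eval]
  have := LinearMap.finrank_le_finrank_of_surjective hsurj
  simp [hc] at this
  omega

theorem Dat.nilp (_ : Dat k m f) (g : R2) (hg : ∀ q ∈ Crit f, eval q g = 0) :
    IsNilpotent (Ideal.Quotient.mk (JI f) g) := by
  have h : g ∈ (JI f).radical := by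
    rw [← vanishingIdeal_zeroLocus_eq_radical (K := ℂ), mem_vanishingIdeal_iff]
    intro x hx
    rw [mem_zeroLocus_iff] at hx
    have h0 := hx (pderiv 0 f) (Ideal.subset_span (by simp))
    have h1 := hx (pderiv 1 f) (Ideal.subset_span (by simp))
    rw [aeval_eq_eval] at *
    exact hg x ⟨h0, h1⟩
  obtain ⟨n, hn⟩ := h
  exact ⟨n, by rw [← map_pow]; exact Ideal.Quotient.eq_zero_iff_mem.2 hn⟩

theorem Dat.sg_JI (D : Dat k m f) : JI f ≤ (JI f).comap sg := by
  intro g hg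
  obtain ⟨u, v, rfl⟩ := Ideal.mem_span_pair.1 hg
  rw [Ideal.mem_comap, map_add, map_mul, map_mul, sg_pderiv, sg_pderiv, D.hsg]
  exact Ideal.mem_span_pair.2 ⟨_, _, rfl⟩

/-- Conjugation on the Jacobian ring. -/
noncomputable def Dat.sB (D : Dat k m f) : BB f →+* BB f := Ideal.quotientMap _ sg D.sg_JI

theorem Dat.sB_mk (D : Dat k m f) (g : R2) :
    D.sB (Ideal.Quotient.mk _ g) = Ideal.Quotient.mk _ (sg g) := by
  simp [Dat.sB]

theorem Dat.sB_sB (D : Dat k m f) (x : BB f) : D.sB (D.sB x) = x := by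
  obtain ⟨g, rfl⟩ := Ideal.Quotient.mk_surjective x
  rw [D.sB_mk, D.sB_mk, sg_sg]

theorem Dat.sB_smul (D : Dat k m f) (c : ℂ) (x : BB f) :
    D.sB (c • x) = starRingEnd ℂ c • D.sB x := by
  obtain ⟨g, rfl⟩ := Ideal.Quotient.mk_surjective x
  have : ∀ (c : ℂ) (g : R2), c • Ideal.Quotient.mk (JI f) g = Ideal.Quotient.mk (JI f) (C c * g) := by
    intro c g
    rw [← MvPolynomial.smul_eq_C_mul]; rfl
  rw [this, D.sB_mk, D.sB_mk, map_mul, sg_C, this]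

theorem cj_crit (D : Dat k m f) {q} (hq : q ∈ Crit f) : cj q ∈ Crit f := by
  constructor
  · rw [← D.hsg, ← sg_pderiv, eval_sg, cj_cj, hq.1]; simp
  · rw [← D.hsg, ← sg_pderiv, eval_sg, cj_cj, hq.2]; simp

theorem cj_nod (D : Dat k m f) {q} (hq : q ∈ Nod f) : cj q ∈ Nod f := by
  refine ⟨?_, cj_crit D hq.2⟩
  rw [← D.hsg, eval_sg, cj_cj, hq.1]; simp

/-- eigenvector -/
def Eig (f : R2) (p : Fin 2 → ℂ) (e : BB f) : Prop :=
  ∀ g : R2, Ideal.Quotient.mk (JI f) g * e = (eval p g) • e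

theorem Eig.mul {p q} {e e' : BB f} (h : Eig f p e) (h' : Eig f q e') (hpq : p ≠ q) : e * e' = 0 := by
  obtain ⟨i, hi⟩ := Function.ne_iff.1 hpq
  have h1 := h (X i)
  have h2 := h' (X i)
  simp only [eval_X] at h1 h2
  have : (p i - q i) • (e * e') = 0 := by
    rw [sub_smul, ← smul_mul_assoc, ← h1, ← mul_smul_comm, ← h2]; ring
  rcases smul_eq_zero.1 this with h | h
  · exact absurd (sub_eq_zero.1 h) hi
  · exact h

theorem Eig.conj (D : Dat k m f) {p} {e : BB f} (h : Eig f p e) : Eig f (cj p) (D.sB e) := by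
  intro g
  have := congrArg D.sB (h (sg g))
  rw [map_mul, D.sB_mk, sg_sg, D.sB_smul, eval_sg] at this
  simpa using this

theorem Dat.exists_e (D : Dat k m f) {p} (hp : p ∈ Nod f) :
    ∃ E ∈ RL (m + m + 1), ell m f E = (m + 2 : ℕ) / Jac f p ∧ eval p E = 1 ∧
      Eig f p (Ideal.Quotient.mk (JI f) E) := by
  have hJ : Jac f p ≠ 0 := D.node p hp.1 hp.2.1 hp.2.2
  obtain ⟨E, hE, h1, h2, h3⟩ := D.bez p hp.2.1 hp.2.2
  change eval p E = Jac f p at h2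
  refine ⟨(Jac f p)⁻¹ • E, Submodule.smul_mem _ _ hE, ?_, ?_, ?_⟩
  · rw [map_smul, h1, smul_eq_mul, div_eq_inv_mul]
  · rw [smul_eval, h2, inv_mul_cancel₀ hJ]
  · intro g
    have h4 := Ideal.Quotient.eq_zero_iff_mem.2 (h3 g)
    rw [sub_mul, map_sub, sub_eq_zero, map_mul, ← smul_eq_C_mul] at h4
    have h5 : ∀ (c : ℂ) (g : R2), Ideal.Quotient.mk (JI f) (c • g) = c • Ideal.Quotient.mk (JI f) g :=
      fun _ _ => rfl
    rw [h5] at h4 ⊢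
    rw [mul_smul_comm, h4, smul_comm]

end
end FC

end


section
namespace FC
section
variable {k m : ℕ} {f : R2}

theorem Dat.unit (D : Dat k m f) (g : R2) (hg : ∀ q ∈ Crit f, eval q g ≠ 0) :
    IsUnit (Ideal.Quotient.mk (JI f) g) := by
  obtain ⟨G, hG⟩ := interp D.crit_fin.toFinset (fun q => (eval q g)⁻¹)
  have h := D.nilp (G * g - 1) (by
    intro q hq
    rw [map_sub, map_mul, hG q (by simpa using hq), inv_mul_cancel₀ (hg q hq)]; simp)
  have h2 := h.isUnit_one_add
  rw [map_sub, map_one, add_sub_cancel, map_mul] at h2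
  exact isUnit_of_mul_isUnit_right h2

theorem Eig.ev {p q} {E : R2} (h : Eig f p (Ideal.Quotient.mk (JI f) E)) (hq : q ∈ Crit f)
    (hpq : p ≠ q) : eval q E = 0 := by
  obtain ⟨i, hi⟩ := Function.ne_iff.1 hpq
  have h1 := h (X i)
  have h2 : X i * E - p i • E ∈ JI f := by
    rw [← Ideal.Quotient.eq_zero_iff_mem, map_sub, map_mul, h1, sub_eq_zero, eval_X]; rfl
  have := JI_le_ker hq h2
  rw [map_sub, map_mul, eval_X, smul_eval, ← sub_mul] at this
  rcases mul_eq_zero.1 this with h | h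
  · exact absurd (sub_eq_zero.1 h).symm hi
  · exact h

theorem Dat.nod_fin (D : Dat k m f) : (Nod f).Finite := D.crit_fin.subset fun _ h => h.2

theorem Dat.e0 (D : Dat k m f) : ∃ E0 : R2, (∀ p ∈ Nod f, eval p E0 = 1) ∧
    (∀ p ∈ Crit f, p ∉ Nod f → eval p E0 = 0) ∧
    Ideal.Quotient.mk (JI f) E0 * Ideal.Quotient.mk (JI f) E0 = Ideal.Quotient.mk (JI f) E0 ∧
    D.sB (Ideal.Quotient.mk (JI f) E0) = Ideal.Quotient.mk (JI f) E0 ∧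
    (∀ g : R2, (∀ p ∈ Nod f, eval p g = 0) →
      Ideal.Quotient.mk (JI f) g * Ideal.Quotient.mk (JI f) E0 = 0) := by
  classical
  choose! E hE hl hev hEig using fun p (hp : p ∈ Nod f) => D.exists_e hp
  have hN : ∀ p, p ∈ D.nod_fin.toFinset ↔ p ∈ Nod f := by simp
  let E0 : R2 := ∑ p ∈ D.nod_fin.toFinset, E p
  have h1 : ∀ p ∈ Nod f, eval p E0 = 1 := by
    intro p hp
    simp only [E0, map_sum]
    rw [Finset.sum_eq_single p, hev p hp]
    · intro q hq hqp
      exact (hEig q ((hN q).1 hq)).ev hp.2 hqp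
    · intro h; exact absurd ((hN p).2 hp) h
  have h2 : ∀ p ∈ Crit f, p ∉ Nod f → eval p E0 = 0 := by
    intro p hp hp'
    simp only [E0, map_sum]
    apply Finset.sum_eq_zero
    intro q hq
    refine (hEig q ((hN q).1 hq)).ev hp ?_
    rintro rfl; exact hp' ((hN _).1 hq)
  have h3 : ∀ x : R2, Ideal.Quotient.mk (JI f) x * Ideal.Quotient.mk (JI f) E0
      = ∑ p ∈ D.nod_fin.toFinset, (eval p x) • Ideal.Quotient.mk (JI f) (E p) := by
    intro x
    simp only [E0, map_sum, Finset.mul_sum]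
    exact Finset.sum_congr rfl fun p hp => hEig p ((hN p).1 hp) x
  have h4 : D.sB (Ideal.Quotient.mk (JI f) E0) * Ideal.Quotient.mk (JI f) E0
      = D.sB (Ideal.Quotient.mk (JI f) E0) := by
    conv_lhs => rw [mul_comm]
    conv_lhs => arg 2; simp only [E0, map_sum]
    conv_rhs => simp only [E0, map_sum]
    rw [Finset.mul_sum]
    refine Finset.sum_congr rfl fun p hp => ?_
    have := ((hEig p ((hN p).1 hp)).conj D) E0
    rw [this, h1 _ (cj_nod D ((hN p).1 hp)), one_smul]
  refine ⟨E0, h1, h2, ?_, ?_, ?_⟩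
  · rw [h3]
    simp only [E0, map_sum]
    refine Finset.sum_congr rfl fun p hp => ?_
    have := h1 p ((hN p).1 hp)
    simp only [E0, map_sum] at this
    rw [this, one_smul]
  · have h5 := congrArg D.sB h4
    rw [map_mul, D.sB_sB, mul_comm, h4] at h5
    exact h5
  · intro g hg
    rw [h3]
    refine Finset.sum_eq_zero fun p hp => ?_
    rw [hg p ((hN p).1 hp), zero_smul]

/-- one half of the nonreal points -/
def Pos (q : Fin 2 → ℂ) : Prop := 0 < (q 0).im ∨ ((q 0).im = 0 ∧ 0 < (q 1).im)

theorem Pos.not_cj {q} (h : Pos q) : ¬ Pos (cj q) := by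
  unfold Pos cj at *; simp
  rcases h with h | ⟨h1, h2⟩
  · exact ⟨by linarith, fun h' => by linarith⟩
  · exact ⟨by linarith, fun _ => by linarith⟩

theorem Pos.ne {q} (h : Pos q) : cj q ≠ q := by
  intro h'; exact h.not_cj (by rwa [h'])

theorem pos_or (q) (h : cj q ≠ q) (h' : ¬ Pos q) : Pos (cj q) := by
  unfold Pos cj at *
  simp only [Complex.conj_im]
  by_contra! h3
  push Not at h'
  apply h
  have h0 : (q 0).im = 0 := by linarith [h'.1, h3.1]
  have h1 : (q 1).im = 0 := by
    have := h'.2 h0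
    have := h3.2 (by linarith)
    linarith
  funext i
  fin_cases i
  · exact Complex.conj_eq_iff_im.2 h0
  · exact Complex.conj_eq_iff_im.2 h1

theorem sym_sqrt (S : Finset (Fin 2 → ℂ)) (hS : ∀ q ∈ S, cj q ∈ S) (u : (Fin 2 → ℂ) → ℂ)
    (hu : ∀ q ∈ S, u (cj q) = starRingEnd ℂ (u q))
    (hr : ∀ q ∈ S, cj q = q → ∃ t : ℝ, 0 ≤ t ∧ u q = t) :
    ∃ H : R2, sg H = H ∧ ∀ q ∈ S, eval q H ^ 2 = u q := by
  classical
  have hc : ∀ z : ℂ, ∃ c : ℂ, c ^ 2 = z := fun z => IsAlgClosed.exists_pow_nat_eq z (by norm_num)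
  choose c hc using hc
  let η : (Fin 2 → ℂ) → ℂ := fun q => if cj q = q then ((Real.sqrt (u q).re : ℝ) : ℂ)
    else if Pos q then c (u q) else starRingEnd ℂ (c (u (cj q)))
  have h1 : ∀ q ∈ S, η q ^ 2 = u q := by
    intro q hq
    simp only [η]
    split_ifs with h h'
    · obtain ⟨t, ht, h2⟩ := hr q hq h
      rw [h2]
      rw [Complex.ofReal_re, ← Complex.ofReal_pow, Real.sq_sqrt ht]
    · exact hc _
    · rw [← map_pow, hc, hu q hq, Complex.conj_conj]
  have h2 : ∀ q ∈ S, η (cj q) = starRingEnd ℂ (η q) := by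
    intro q hq
    simp only [η]
    by_cases h : cj q = q
    · rw [cj_cj]; rw [if_pos h.symm, if_pos h, h, Complex.conj_ofReal]
    · rw [cj_cj, if_neg (Ne.symm h), if_neg h]
      by_cases h' : Pos q
      · rw [if_neg h'.not_cj, if_pos h']
      · rw [if_pos (pos_or q h h'), if_neg h', Complex.conj_conj]
  obtain ⟨H, hH⟩ := interp S η
  refine ⟨C (1/2) * (H + sg H), ?_, ?_⟩
  · rw [map_mul, sg_C, map_add, sg_sg, add_comm]; simp
    left; exact Complex.conj_eq_iff_im.2 rfl
  · intro q hq
    rw [← h1 q hq, map_mul, eval_C, map_add, eval_sg, hH q hq, hH _ (hS q hq), h2 q hq,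
      Complex.conj_conj]
    ring

theorem Dat.sqrt (D : Dat k m f) : (∃ h : BB f, h * h = Ideal.Quotient.mk (JI f) f ∧ D.sB h = h ∧
      (∀ p e, p ∈ Nod f → Eig f p e → h * e = 0)) ∧
    ∀ w : R2, Ideal.Quotient.mk (JI f) w * Ideal.Quotient.mk (JI f) f = 0 →
      ∀ g : R2, (∀ p ∈ Nod f, eval p g = 0) → g * w ∈ JI f := by
  classical
  obtain ⟨E0, e1, e2, e3, e4, e5⟩ := D.e0
  have hU : ∀ q ∈ Crit f, eval q (f + E0) = eval q f + if q ∈ Nod f then 1 else 0 := by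
    intro q hq
    rw [map_add]; split_ifs with h
    · rw [e1 q h]
    · rw [e2 q hq h]
  have hunit : IsUnit (Ideal.Quotient.mk (JI f) (f + E0)) := by
    apply D.unit
    intro q hq
    rw [hU q hq]
    split_ifs with h
    · rw [h.1]; simp
    · rw [add_zero]; intro h'; exact h ⟨h', hq⟩
  have hf0 := e5 f fun p hp => hp.1
  have hfu : Ideal.Quotient.mk (JI f) (f + E0) * (1 - Ideal.Quotient.mk (JI f) E0)
      = Ideal.Quotient.mk (JI f) f := by
    rw [map_add]
    linear_combination - hf0 - e3
  constructor
  · obtain ⟨H, hH, hH2⟩ := sym_sqrt D.crit_fin.toFinset (by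
      intro q hq; simp only [Set.Finite.mem_toFinset] at *; exact cj_crit D hq)
      (fun q => eval q (f + E0)) (by
        intro q hq
        simp only [Set.Finite.mem_toFinset] at hq
        rw [hU q hq, hU _ (cj_crit D hq)]
        have h1 : eval (cj q) f = starRingEnd ℂ (eval q f) := by
          conv_lhs => rw [← D.hsg]
          rw [eval_sg, cj_cj]
        have h2 : cj q ∈ Nod f ↔ q ∈ Nod f :=
          ⟨fun h => by have := cj_nod D h; rwa [cj_cj] at this, cj_nod D⟩
        rw [h1, map_add]
        simp only [h2]
        split_ifs <;> simp) (by
        intro q hq hq'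
        simp only [Set.Finite.mem_toFinset] at hq
        rw [hU q hq]
        obtain ⟨y, hy, h⟩ := D.pos (fun i => (q i).re)
        have : (fun i => (((q i).re : ℝ) : ℂ)) = q := by
          funext i
          exact Complex.conj_eq_iff_re.1 (congrFun hq' i)
        rw [this] at h
        rw [h]
        split_ifs
        · exact ⟨y + 1, by linarith, by simp⟩
        · exact ⟨y, hy, by simp⟩)
    simp only [Set.Finite.mem_toFinset] at hH2
    have hHu : IsUnit (Ideal.Quotient.mk (JI f) H) := by
      have := D.unit (H * H) (by
        intro q hq
        rw [map_mul, ← pow_two, hH2 q hq]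
        rw [hU q hq]
        split_ifs with h
        · rw [h.1]; simp
        · rw [add_zero]; intro h'; exact h ⟨h', hq⟩)
      rw [map_mul] at this
      exact isUnit_of_mul_isUnit_left this
    let u := Ideal.Quotient.mk (JI f) (f + E0)
    let Pp : Polynomial (BB f) := Polynomial.X ^ 2 - Polynomial.C u
    obtain ⟨r, ⟨hr1, hr2⟩, hr3⟩ := Polynomial.existsUnique_nilpotent_sub_and_aeval_eq_zero (P := Pp)
      (x := Ideal.Quotient.mk (JI f) H) (by
        have := D.nilp (H ^ 2 - (f + E0)) (by
          intro q hq; rw [map_sub, map_pow, hH2 q hq, sub_self])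
        simpa [Pp, u] using this) (by
        have h2 : IsUnit (2 : BB f) := by
          have := (isUnit_iff_ne_zero.2 (two_ne_zero (α := ℂ))).map (algebraMap ℂ (BB f))
          rwa [map_ofNat] at this
        have := h2.mul hHu
        simpa [Pp, one_add_one_eq_two] using this)
    have hrr : r ^ 2 = u := by
      have : r ^ 2 - u = 0 := by simpa [Pp] using hr2
      exact sub_eq_zero.1 this
    have hu : D.sB u = u := by
      simp only [u]; rw [map_add, map_add, e4, D.sB_mk, D.hsg]
    have hsr : D.sB r = r := by
      apply hr3
      refine ⟨?_, ?_⟩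
      · have := hr1.map D.sB
        rwa [map_sub, D.sB_mk, hH] at this
      · have : (D.sB r) ^ 2 = u := by rw [← map_pow, hrr, hu]
        simp [Pp, this]
    refine ⟨r * (1 - Ideal.Quotient.mk (JI f) E0), ?_, ?_, ?_⟩
    · rw [← hfu]
      linear_combination (1 - Ideal.Quotient.mk (JI f) E0) ^ 2 * hrr + u * e3
    · rw [map_mul, hsr, map_sub, map_one, e4]
    · intro p e hp he
      rw [mul_assoc, sub_mul, he E0, e1 p hp]; simp
  · intro w hw g hg
    rw [← hfu] at hw
    have h1 : Ideal.Quotient.mk (JI f) w * (1 - Ideal.Quotient.mk (JI f) E0) = 0 := by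
      apply hunit.mul_left_cancel
      rw [mul_zero, ← hw]; ring
    have h2 := e5 g hg
    rw [← Ideal.Quotient.eq_zero_iff_mem, map_mul]
    linear_combination (Ideal.Quotient.mk (JI f) g) * h1 + (Ideal.Quotient.mk (JI f) w) * h2

end
end FC

end


section
namespace FC
section
variable {k m : ℕ} {f : R2}

theorem Dat.f1 (D : Dat k m f) : ∃ c : ℂ, ∃ f1 ∈ RL (m + 2), 
    f = f1 + C c * (X 0 * pderiv 0 f + X 1 * pderiv 1 f) := by
  refine ⟨((m + 2 : ℕ) : ℂ)⁻¹, f - C ((m + 2 : ℕ) : ℂ)⁻¹ * (X 0 * pderiv 0 f + X 1 * pderiv 1 f), ?_, by ring⟩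
  have x0 := mem_RL_X0 0
  have x1 := mem_RL_X1 0
  rw [C_0, sub_zero] at x0 x1
  have h0 : X 0 * pderiv 0 f ∈ RL (1 + (m + 1) + 1) := mul_mem_RL x0.1 D.ha
  have h1 : X 1 * pderiv 1 f ∈ RL (1 + (m + 1) + 1) := mul_mem_RL x1.1 D.hb
  have t0 : T (1 + (m + 1)) (X 0 * pderiv 0 f) = _ := T_mul x0.1 D.ha
  have t1 : T (1 + (m + 1)) (X 1 * pderiv 1 f) = _ := T_mul x1.1 D.hb
  rw [x0.2, D.hTa] at t0
  rw [x1.2, D.hTb] at t1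
  rw [show 1 + (m + 1) = m + 2 by ring] at *
  have key : f - C ((m + 2 : ℕ) : ℂ)⁻¹ * (X 0 * pderiv 0 f + X 1 * pderiv 1 f) ∈ RL (m + 2 + 1) := by
    rw [← smul_eq_C_mul]
    exact Submodule.sub_mem _ D.hf (Submodule.smul_mem _ _ (Submodule.add_mem _ h0 h1))
  refine RL_of_succ key ?_
  rw [← smul_eq_C_mul, map_sub, map_smul, map_add, t0, t1]
  have : ((m + 2 : ℕ) : ℂ) ≠ 0 := Nat.cast_ne_zero.2 (by omega)
  have h2 : Polynomial.X * Polynomial.derivative (T (m + 2) f) + 1 * (((m + 2 : ℕ) : Polynomial ℂ) * T (m + 2) f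
    - Polynomial.X * Polynomial.derivative (T (m + 2) f)) = ((m + 2 : ℕ) : ℂ) • T (m + 2) f := by
    rw [Polynomial.smul_eq_C_mul, Polynomial.C_eq_natCast]; ring
  rw [h2, smul_smul, inv_mul_cancel₀ this, one_smul, sub_self]

theorem Dat.f_ne (D : Dat k m f) : f ≠ 0 := by
  intro h
  have := D.hnat
  rw [h] at this; simp at this

theorem Dat.inj (D : Dat k m f) (w : R2) (hw : w ∈ RL (k - 1)) (hwf : w * f ∈ JI f) : w = 0 := by
  have hm := D.hm
  obtain ⟨c, f1, hf1, hff⟩ := D.f1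
  have hwf1 : w * f1 ∈ JI f := by
    have : w * f1 = w * f - (w * C c * X 0 * pderiv 0 f + w * C c * X 1 * pderiv 1 f) := by
      linear_combination - w * hff
    rw [this]
    exact Ideal.sub_mem _ hwf (Ideal.mem_span_pair.2 ⟨_, _, rfl⟩)
  obtain ⟨α, hα, β, hβ, hab⟩ := ideal_RL D.ha D.hb D.hcop D.hdeg D.hne (k - 1) _ hwf1
    (mul_mem_RL' hw hf1)
  have x0 := mem_RL_X0 0
  have x1 := mem_RL_X1 0
  rw [C_0, sub_zero] at x0 x1
  obtain ⟨α', hα', e1⟩ : ∃ α' ∈ RL (k - 1 + 1), α' = α + w * C c * X 0 := by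
    refine ⟨_, Submodule.add_mem _ (RL_mono (by omega) hα) ?_, rfl⟩
    have := Submodule.smul_mem _ c (mul_mem_RL' hw x0.1)
    rw [smul_eq_C_mul] at this
    convert this using 1; ring
  obtain ⟨β', hβ', e2⟩ : ∃ α' ∈ RL (k - 1 + 1), α' = β + w * C c * X 1 := by
    refine ⟨_, Submodule.add_mem _ (RL_mono (by omega) hβ) ?_, rfl⟩
    have := Submodule.smul_mem _ c (mul_mem_RL' hw x1.1)
    rw [smul_eq_C_mul] at this
    convert this using 1; ring
  have e3 : w * f = pderiv 0 f * α' + pderiv 1 f * β' := by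
    rw [e1, e2]; linear_combination w * hff + hab
  have hv : ∀ p ∈ Nod f, eval p α' = 0 ∧ eval p β' = 0 := by
    intro p hp
    have hJ : Jac f p ≠ 0 := D.node p hp.1 hp.2.1 hp.2.2
    have d0 := congrArg (fun g => eval p (pderiv 0 g)) e3
    have d1 := congrArg (fun g => eval p (pderiv 1 g)) e3
    simp only [Derivation.leibniz, map_add, smul_eq_mul, map_mul, hp.1, hp.2.1, hp.2.2] at d0 d1
    constructor
    · apply (mul_eq_zero.1 (show Jac f p * _ = 0 from ?_)).resolve_left hJ
      rw [Jac]
      linear_combination eval p (pderiv 0 (pderiv 1 f)) * d1 - eval p (pderiv 1 (pderiv 1 f)) * d0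
    · apply (mul_eq_zero.1 (show Jac f p * _ = 0 from ?_)).resolve_left hJ
      rw [Jac]
      linear_combination eval p (pderiv 1 (pderiv 0 f)) * d0 - eval p (pderiv 0 (pderiv 0 f)) * d1
  have hann := D.sqrt.2 w (by rw [← map_mul]; exact Ideal.Quotient.eq_zero_iff_mem.2 hwf)
  have z1 : α' * w = 0 := ideal_RL_zero D.ha D.hb D.hcop D.hdeg D.hne _
    (hann α' fun p hp => (hv p hp).1) (by
      rw [mul_comm]; exact RL_mono (by omega) (mul_mem_RL' hw hα'))
  have z2 : β' * w = 0 := ideal_RL_zero D.ha D.hb D.hcop D.hdeg D.hne _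
    (hann β' fun p hp => (hv p hp).2) (by
      rw [mul_comm]; exact RL_mono (by omega) (mul_mem_RL' hw hβ'))
  by_contra h
  have y1 := (mul_eq_zero.1 z1).resolve_right h
  have y2 := (mul_eq_zero.1 z2).resolve_right h
  rw [y1, y2, mul_zero, mul_zero, add_zero] at e3
  rcases mul_eq_zero.1 e3 with h' | h'
  · exact h h'
  · exact D.f_ne h'

end
end FC

end


section
namespace FC
section
variable {k m : ℕ} {f : R2}

theorem Dat.jac_pos (D : Dat k m f) {p} (hp : p ∈ Nod f) (hr : cj p = p) :
    ∃ t : ℝ, 0 < t ∧ Jac f p = t := by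
  obtain ⟨g1, -, g2, -, hg⟩ := taylor p (m + 2) f D.hf
  rw [hp.1, C_0, add_zero] at hg
  obtain ⟨d1, hd1⟩ := exists_RL g1
  obtain ⟨d2, hd2⟩ := exists_RL g2
  obtain ⟨a1, -, a2, -, ha⟩ := taylor p d1 g1 (RL_mono (by omega) hd1)
  obtain ⟨b1, -, b2, -, hb⟩ := taylor p d2 g2 (RL_mono (by omega) hd2)
  have z1 : eval p g1 = 0 := by
    have := hp.2.1
    rw [hg] at this
    simpa [Derivation.leibniz, pderiv_X] using this
  have z2 : eval p g2 = 0 := by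
    have := hp.2.2
    rw [hg] at this
    simpa [Derivation.leibniz, pderiv_X] using this
  rw [z1, C_0, add_zero] at ha
  rw [z2, C_0, add_zero] at hb
  have hfq : f = a1 * (X 0 - C (p 0)) ^ 2 + (a2 + b1) * ((X 0 - C (p 0)) * (X 1 - C (p 1)))
      + b2 * (X 1 - C (p 1)) ^ 2 := by
    rw [hg, ha, hb]; ring
  have hJ : Jac f p = 4 * eval p a1 * eval p b2 - (eval p a2 + eval p b1) ^ 2 := by
    rw [Jac]
    have e00 : eval p (pderiv 0 (pderiv 0 f)) = 2 * eval p a1 := by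
      rw [hfq]; simp [Derivation.leibniz, Derivation.leibniz_pow, pderiv_X]; try ring
    have e11 : eval p (pderiv 1 (pderiv 1 f)) = 2 * eval p b2 := by
      rw [hfq]; simp [Derivation.leibniz, Derivation.leibniz_pow, pderiv_X]; try ring
    have e01 : eval p (pderiv 0 (pderiv 1 f)) = eval p a2 + eval p b1 := by
      rw [hfq]; simp [Derivation.leibniz, Derivation.leibniz_pow, pderiv_X]; try ring
    have e10 : eval p (pderiv 1 (pderiv 0 f)) = eval p a2 + eval p b1 := by
      rw [hfq]; simp [Derivation.leibniz, Derivation.leibniz_pow, pderiv_X]; try ring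
    rw [e00, e11, e01, e10]; ring
  have hpr : ∀ i, (((p i).re : ℝ) : ℂ) = p i := fun i => Complex.conj_eq_iff_re.1 (congrFun hr i)
  have key : ∀ s t : ℝ, ∃ y : ℝ, 0 ≤ y ∧
      eval p a1 * s ^ 2 + (eval p a2 + eval p b1) * (s * t) + eval p b2 * t ^ 2 = y := by
    intro s t
    let v : ℝ → Fin 2 → ℂ := fun ε i => p i + ε * (if i = 0 then (s : ℂ) else t)
    let q : ℝ → ℂ := fun ε => eval (v ε) a1 * s ^ 2 + (eval (v ε) a2 + eval (v ε) b1) * (s * t)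
      + eval (v ε) b2 * t ^ 2
    have hv : Continuous v := by fun_prop
    have hcont : ∀ g : R2, Continuous fun ε => eval (v ε) g := fun g =>
      (MvPolynomial.continuous_eval g).comp hv
    have hq : Continuous q := by
      have h1 := hcont a1
      have h2 := hcont a2
      have h3 := hcont b1
      have h4 := hcont b2
      simp only [q]
      fun_prop
    have hcl : IsClosed {ε : ℝ | 0 ≤ (q ε).re ∧ (q ε).im = 0} :=
      (isClosed_le continuous_const (Complex.continuous_re.comp hq)).inter
        (isClosed_eq (Complex.continuous_im.comp hq) continuous_const)
    have hsub : ({0}ᶜ : Set ℝ) ⊆ {ε : ℝ | 0 ≤ (q ε).re ∧ (q ε).im = 0} := by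
      intro ε hε
      obtain ⟨y, hy, h⟩ := D.pos (fun i => (p i).re + ε * (if i = 0 then s else t))
      have hve : (fun i => (((p i).re + ε * (if i = 0 then s else t) : ℝ) : ℂ)) = v ε := by
        funext i
        push_cast
        rw [hpr]
        simp only [v]; split_ifs <;> rfl
      rw [hve] at h
      have h2 : eval (v ε) f = ε ^ 2 * q ε := by
        conv_lhs => rw [hfq]
        simp [v, q]; ring
      have hε' : (ε : ℂ) ≠ 0 := by exact_mod_cast hε
      have h3 : q ε = ((y / ε ^ 2 : ℝ) : ℂ) := by
        push_cast
        rw [← h, h2]; field_simp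
      simp only [Set.mem_ofPred_eq, h3, Complex.ofReal_re, Complex.ofReal_im, and_true]
      positivity
    have h0 : (0 : ℝ) ∈ {ε : ℝ | 0 ≤ (q ε).re ∧ (q ε).im = 0} := by
      have := hcl.closure_subset_iff.2 hsub
      rw [(dense_compl_singleton (0 : ℝ)).closure_eq] at this
      exact this trivial
    have hq0 : q 0 = eval p a1 * s ^ 2 + (eval p a2 + eval p b1) * (s * t) + eval p b2 * t ^ 2 := by
      simp [q, v]
    refine ⟨(q 0).re, h0.1, ?_⟩
    rw [← hq0]
    exact (Complex.ext (by simp) (by simp [h0.2]))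
  obtain ⟨A, hA, hA'⟩ := key 1 0
  obtain ⟨Cc, hC, hC'⟩ := key 0 1
  obtain ⟨S, hS, hS'⟩ := key 1 1
  simp at hA' hC' hS'
  have hB : eval p a2 + eval p b1 = ((S - A - Cc : ℝ) : ℂ) := by
    push_cast
    rw [← hS', hA', hC']; ring
  have hq : ∀ s t : ℝ, 0 ≤ A * s ^ 2 + (S - A - Cc) * (s * t) + Cc * t ^ 2 := by
    intro s t
    obtain ⟨y, hy, h⟩ := key s t
    rw [hA', hB, hC'] at h
    have : A * s ^ 2 + (S - A - Cc) * (s * t) + Cc * t ^ 2 = y := by exact_mod_cast h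
    rw [this]; exact hy
  set B := S - A - Cc with hBdef
  refine ⟨4 * A * Cc - B ^ 2, ?_, ?_⟩
  · have hne : 4 * A * Cc - B ^ 2 ≠ 0 := by
      have : Jac f p ≠ 0 := D.node p hp.1 hp.2.1 hp.2.2
      rw [hJ, hA', hB, hC'] at this
      intro h
      apply this
      exact_mod_cast h
    apply lt_of_le_of_ne _ hne.symm
    have := discrim_le_zero (a := A) (b := B) (c := Cc) (fun x => by
      have := hq x 1
      nlinarith)
    rw [discrim] at this
    linarith
  · rw [hJ, hA', hB, hC']; push_cast; ring

theorem Dat.herm_dim (D : Dat k m f) (L : BB f →ₗ[ℂ] ℂ) (U Z : Submodule ℂ (BB f))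
    (hU : ∀ u ∈ U, 0 ≤ (L (u * D.sB u)).re) (hZ : ∀ u ∈ Z, (L (u * D.sB u)).re ≤ 0)
    (hrad : ∀ z ∈ Z, (∀ v, (L (z * D.sB v) + L (v * D.sB z)).re = 0) → z = 0) :
    Module.finrank ℂ U + Module.finrank ℂ Z ≤ (m + 1) ^ 2 := by
  obtain ⟨h1, h2⟩ := D.finB
  have hfin : FiniteDimensional ℝ (BB f) := Module.Finite.trans ℂ _
  have hsB : ∀ (c : ℝ) (x : BB f), D.sB (c • x) = c • D.sB x := by
    intro c x
    rw [← Complex.coe_smul, D.sB_smul, Complex.conj_ofReal, Complex.coe_smul]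
  have hL : ∀ (c : ℝ) (x : BB f), L (c • x) = c * L x := by
    intro c x
    rw [← Complex.coe_smul, map_smul, smul_eq_mul]
  let β : BB f →ₗ[ℝ] BB f →ₗ[ℝ] ℝ := LinearMap.mk₂ ℝ
    (fun x y => (L (x * D.sB y) + L (y * D.sB x)).re)
    (by intro x y z; simp only [add_mul, map_add, mul_add, Complex.add_re]; ring)
    (by
      intro c x y
      rw [hsB, smul_mul_assoc, mul_smul_comm, hL, hL, ← mul_add, Complex.re_ofReal_mul]; rfl)
    (by intro x y z; simp only [add_mul, map_add, mul_add, Complex.add_re]; ring)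
    (by
      intro c x y
      rw [hsB, smul_mul_assoc, mul_smul_comm, hL, hL, ← mul_add, Complex.re_ofReal_mul]; rfl)
  have hβ : ∀ x y, β x y = (L (x * D.sB y) + L (y * D.sB x)).re := fun x y => rfl
  have key := semidef_dim β (fun x y => by rw [hβ, hβ, add_comm])
    (U.restrictScalars ℝ) (Z.restrictScalars ℝ)
    (fun u hu => by rw [hβ, Complex.add_re]; linarith [hU u hu])
    (fun u hu => by rw [hβ, Complex.add_re]; linarith [hZ u hu])
    (fun z hz h => hrad z hz h)
  have e1 : Module.finrank ℝ (U.restrictScalars ℝ) = 2 * Module.finrank ℂ U :=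
    finrank_real_of_complex U
  have e2 : Module.finrank ℝ (Z.restrictScalars ℝ) = 2 * Module.finrank ℂ Z :=
    finrank_real_of_complex Z
  have e3 := finrank_real_of_complex (BB f)
  omega

theorem Dat.exU (D : Dat k m f) (L : BB f →ₗ[ℂ] ℂ)
    (hL : ∀ g ∈ RL (m + m + 1), L (Ideal.Quotient.mk _ g) = ell m f g)
    (S : Finset (Fin 2 → ℂ)) (hS : ∀ p ∈ S, p ∈ Nod f) (hS' : ∀ p ∈ S, cj p ∈ S → cj p = p) :
    ∃ U : Submodule ℂ (BB f), (∀ u ∈ U, 0 ≤ (L (u * D.sB u)).re) ∧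
      (k - 1) * k / 2 + S.card ≤ Module.finrank ℂ U := by
  classical
  obtain ⟨h, hh, hsh, hhe⟩ := D.sqrt.1
  choose E hE hl hev hEig using fun p : S => D.exists_e (hS p.1 p.2)
  let e : S → BB f := fun p => Ideal.Quotient.mk (JI f) (E p)
  have he : ∀ p, e p = Ideal.Quotient.mk (JI f) (E p) := fun p => rfl
  have hee : ∀ p q, p ≠ q → e p * e q = 0 := fun p q hpq =>
    (hEig p).mul (hEig q) (fun h' => hpq (Subtype.ext h'))
  have hee' : ∀ p, e p * e p = e p := fun p => by
    have := hEig p (E p)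
    rwa [hev, one_smul] at this
  have hene : ∀ p, e p ≠ 0 := by
    intro p h0
    have := JI_le_ker (hS p.1 p.2).2 (Ideal.Quotient.eq_zero_iff_mem.1 h0)
    rw [hev] at this; exact one_ne_zero this
  have hhep : ∀ p, h * e p = 0 := fun p => hhe _ _ (hS p.1 p.2) (hEig p)
  let Φ1 : RL (k - 1) →ₗ[ℂ] BB f := (LinearMap.mulLeft ℂ h).comp
    ((Ideal.Quotient.mkₐ ℂ (JI f)).toLinearMap.comp (RL (k - 1)).subtype)
  let Φ2 : (S → ℂ) →ₗ[ℂ] BB f := Fintype.linearCombination ℂ e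
  let Φ := LinearMap.coprod Φ1 Φ2
  have hΦ1 : ∀ w, Φ1 w = h * Ideal.Quotient.mk (JI f) w.1 := fun w => rfl
  have hΦ2 : ∀ c, Φ2 c = ∑ p, c p • e p := fun c => by
    simp [Φ2, Fintype.linearCombination_apply]
  have hx : ∀ c, h * Φ2 c = 0 := by
    intro c
    rw [hΦ2, Finset.mul_sum]
    exact Finset.sum_eq_zero fun p _ => by rw [mul_smul_comm, hhep, smul_zero]
  have hinj : Function.Injective Φ := by
    rw [← LinearMap.ker_eq_bot, LinearMap.ker_eq_bot']
    rintro ⟨w, c⟩ h0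
    rw [LinearMap.coprod_apply] at h0
    have hw : w = 0 := by
      have h1 := congrArg (fun x => h * x) h0
      simp only [mul_add, hx, hΦ1, ← mul_assoc, hh, add_zero, mul_zero, ← map_mul] at h1
      apply Subtype.ext
      apply D.inj w.1 w.2
      rw [mul_comm]
      exact Ideal.Quotient.eq_zero_iff_mem.1 h1
    have hc : c = 0 := by
      funext q
      have h1 := congrArg (fun x => x * e q) h0
      simp only [hw, map_zero, zero_add, hΦ2, Finset.sum_mul, zero_mul] at h1
      rw [Finset.sum_eq_single q] at h1
      · rw [smul_mul_assoc, hee'] at h1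
        exact (smul_eq_zero.1 h1).resolve_right (hene q)
      · intro p _ hpq
        rw [smul_mul_assoc, hee p q hpq, smul_zero]
      · simp
    rw [hw, hc]; rfl
  refine ⟨LinearMap.range Φ, ?_, ?_⟩
  · rintro _ ⟨⟨w, c⟩, rfl⟩
    rw [LinearMap.coprod_apply]
    set x := Φ2 c with hxdef
    have h1 : h * x = 0 := hx c
    have h2 : h * D.sB x = 0 := by
      have := congrArg D.sB h1
      rwa [map_mul, hsh, map_zero] at this
    have h3 : (Φ1 w + x) * D.sB (Φ1 w + x) = Ideal.Quotient.mk (JI f) (f * (w.1 * sg w.1)) + x * D.sB x := by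
      rw [hΦ1, map_add, map_mul, hsh, D.sB_mk, map_mul, map_mul, ← hh]
      linear_combination (Ideal.Quotient.mk (JI f) w.1) * h2 + (Ideal.Quotient.mk (JI f) (sg w.1)) * h1
    have h4 : L (Ideal.Quotient.mk (JI f) (f * (w.1 * sg w.1))) = 0 := by
      obtain ⟨c, f1, hf1, hff⟩ := D.f1
      have h5 : Ideal.Quotient.mk (JI f) (f * (w.1 * sg w.1))
          = Ideal.Quotient.mk (JI f) (w.1 * f1 * sg w.1) := by
        rw [Ideal.Quotient.eq]
        refine Ideal.mem_span_pair.2 ⟨w.1 * sg w.1 * C c * X 0, w.1 * sg w.1 * C c * X 1, ?_⟩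
        linear_combination - w.1 * sg w.1 * hff
      have hm := D.hm
      rw [h5]
      have h6 : w.1 * f1 * sg w.1 ∈ RL (m + m) := by
        have hw := w.2
        have hw' := sg_RL w.2
        rcases Nat.lt_or_ge k 2 with hk | hk
        · have : k - 1 = 0 := by omega
          rw [RL_zero (RL_mono this.le hw)]; simp
        · have := mul_mem_RL' (mul_mem_RL' hw hf1) (show sg w.1 ∈ RL (k - 2 + 1) by
            rwa [show k - 2 + 1 = k - 1 by omega])
          exact RL_mono (by omega) this
      rw [hL _ (RL_mono (by omega) h6), ell_apply]
      rw [mem_RL.1 h6 _ le_rfl]; simp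
    rw [h3, map_add, h4, zero_add]
    have h7 : x * D.sB x = ∑ p, c p • (e p * D.sB x) := by
      conv_lhs => arg 1; rw [hxdef, hΦ2]
      rw [Finset.sum_mul]
      exact Finset.sum_congr rfl fun p _ => smul_mul_assoc _ _ _
    rw [h7, map_sum, Complex.re_sum]
    refine Finset.sum_nonneg fun p _ => ?_
    have h8 : D.sB x = ∑ q, starRingEnd ℂ (c q) • D.sB (e q) := by
      rw [hxdef, hΦ2, map_sum]
      exact Finset.sum_congr rfl fun p _ => D.sB_smul _ _
    have h9 : ∀ q : S, cj q.1 ≠ p.1 → e p * D.sB (e q) = 0 := fun q hq =>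
      (hEig p).mul ((hEig q).conj D) hq.symm
    by_cases hp : cj p.1 = p.1
    · have h10 : e p * D.sB x = starRingEnd ℂ (c p) • e p := by
        rw [h8, Finset.mul_sum, Finset.sum_eq_single p]
        · rw [mul_smul_comm]
          congr 1
          have := hEig p (sg (E p))
          rw [eval_sg, hp, hev, map_one, one_smul, ← D.sB_mk, mul_comm] at this
          exact this
        · intro q _ hq
          rw [mul_smul_comm, h9, smul_zero]
          intro h'
          apply hq
          apply Subtype.ext
          have h12 := congrArg cj h'
          rw [cj_cj, hp] at h12
          exact h12
        · simp
      rw [h10, smul_smul, map_smul, he, hL _ (hE p), hl p]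
      obtain ⟨t, ht, hJ⟩ := D.jac_pos (hS p.1 p.2) hp
      rw [hJ, Complex.mul_conj, smul_eq_mul]
      have : ((Complex.normSq (c p) : ℝ) : ℂ) * (((m + 2 : ℕ) : ℂ) / (t : ℂ))
          = ((Complex.normSq (c p) * ((m + 2 : ℕ) / t) : ℝ) : ℂ) := by push_cast; rfl
      rw [this, Complex.ofReal_re]
      have := Complex.normSq_nonneg (c p)
      positivity
    · have h10 : e p * D.sB x = 0 := by
        rw [h8, Finset.mul_sum]
        refine Finset.sum_eq_zero fun q _ => ?_
        rw [mul_smul_comm, h9, smul_zero]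
        intro h'
        have h11 := hS' q.1 q.2 (by rw [h']; exact p.2)
        rw [h'] at h11
        apply hp
        rw [← h11] at h'
        exact h'
      rw [h10]; simp
  · rw [LinearMap.finrank_range_of_inj hinj, Module.finrank_prod, (RL_fin (k - 1)).2]
    simp only [Module.finrank_fintype_fun_eq_card, Fintype.card_coe]
    rcases k with _ | k
    · simp
    · simp

end
end FC

end


section
namespace FC
section
variable {k m : ℕ} {f : R2}

theorem Dat.card_rts (D : Dat k m f) : (rts m f).card = m + 2 := by
  rw [rts, Multiset.toFinset_card_of_nodup (Polynomial.nodup_roots D.hsep),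
    ← (IsAlgClosed.splits (T (m + 2) f)).natDegree_eq_card_roots, D.hnat]

theorem eval_T_sg (d : ℕ) (g : R2) (z : ℂ) :
    (T d (sg g)).eval z = starRingEnd ℂ ((T d g).eval (starRingEnd ℂ z)) := by
  rw [T_sg]
  conv_lhs => rw [← Complex.conj_conj z]
  rw [Polynomial.eval_map, Polynomial.eval₂_at_apply]

theorem Dat.conj_phi (D : Dat k m f) (z : ℂ) : (T (m + 2) f).eval (starRingEnd ℂ z)
    = starRingEnd ℂ ((T (m + 2) f).eval z) := by
  have := eval_T_sg (m + 2) f (starRingEnd ℂ z)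
  rwa [D.hsg, Complex.conj_conj] at this

theorem Dat.conj_dphi (D : Dat k m f) (z : ℂ) :
    (Polynomial.derivative (T (m + 2) f)).eval (starRingEnd ℂ z)
    = starRingEnd ℂ ((Polynomial.derivative (T (m + 2) f)).eval z) := by
  rw [← D.hTa]
  have := eval_T_sg (m + 1) (pderiv 0 f) (starRingEnd ℂ z)
  rwa [sg_pderiv, D.hsg, Complex.conj_conj] at this

theorem Dat.conj_rts (D : Dat k m f) {z : ℂ} (hz : z ∈ rts m f) : starRingEnd ℂ z ∈ rts m f := by
  rw [D.mem_rts] at *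
  rw [D.conj_phi, hz, map_zero]

theorem Dat.im_rts (D : Dat k m f) {z : ℂ} (hz : z ∈ rts m f) : z.im ≠ 0 := by
  intro h
  rw [D.mem_rts] at hz
  apply D.hreal z.re
  rwa [show ((z.re : ℝ) : ℂ) = z from Complex.ext (by simp) (by simp [h])]

theorem Dat.ell_sg (D : Dat k m f) (g : R2) : ell m f (sg g) = starRingEnd ℂ (ell m f g) := by
  rw [ell_apply, ell_apply, map_neg, map_sum]
  rw [neg_inj]
  apply Finset.sum_nbij' (fun z => starRingEnd ℂ z) (fun z => starRingEnd ℂ z)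
  · intro z hz; exact D.conj_rts hz
  · intro z hz; exact D.conj_rts hz
  · intro z hz; exact Complex.conj_conj z
  · intro z hz; exact Complex.conj_conj z
  · intro z hz
    rw [eval_T_sg, map_div₀, map_pow, ← D.conj_dphi, Complex.conj_conj]

theorem Dat.radZ (D : Dat k m f) (g : R2) (hg : g ∈ RL (m + 1))
    (h : ∀ d ≤ m, g ∈ RL (d + 1) → ∀ x ∈ RL (m + m - d + 1), ell m f (g * x) = 0) : g = 0 := by
  have key : ∀ d ≤ m + 1, g ∈ RL d → g = 0 := by
    intro d
    induction d with
    | zero => intro _ h; exact RL_zero h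
    | succ d ih =>
      intro hd hgd
      apply ih (by omega)
      apply RL_of_succ hgd
      set τ := T d g with hτ
      set φ := T (m + 2) f with hφ
      have h1 : ∀ G : Polynomial ℂ, G.natDegree ≤ m + m - d →
          ∑ z ∈ rts m f, τ.eval z * G.eval z / (Polynomial.derivative φ).eval z ^ 2 = 0 := by
        intro G hG
        obtain ⟨x, hx, hxT⟩ := exists_lift _ G hG
        have h2 := h d (by omega) hgd x hx
        have h3 := T_mul hgd hx
        rw [show d + (m + m - d) = m + m by omega] at h3
        rw [ell_apply, neg_eq_zero, h3, hxT] at h2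
        simpa using h2
      have h2 : ∀ z ∈ rts m f, ∀ w ∈ rts m f, z ≠ w →
          τ.eval z / (Polynomial.derivative φ).eval z = τ.eval w / (Polynomial.derivative φ).eval w := by
        intro z hz w hw hzw
        have hz' := (D.mem_rts z).1 hz
        have hw' := (D.mem_rts w).1 hw
        obtain ⟨ψ, hψ⟩ := Polynomial.dvd_iff_isRoot.2 hz'
        have hψw : ψ.eval w = 0 := by
          rw [hψ] at hw'
          simp only [Polynomial.eval_mul, Polynomial.eval_sub, Polynomial.eval_X, Polynomial.eval_C] at hw'
          exact (mul_eq_zero.1 hw').resolve_left (sub_ne_zero.2 hzw.symm)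
        obtain ⟨χ, hχ⟩ := Polynomial.dvd_iff_isRoot.2 hψw
        have hφχ : φ = (Polynomial.X - Polynomial.C z) * ((Polynomial.X - Polynomial.C w) * χ) := by
          rw [← hχ]; exact hψ
        have hχ0 : χ ≠ 0 := by
          rintro rfl
          have := D.hnat
          rw [← hφ, hφχ] at this; simp at this
        have hdeg : χ.natDegree = m := by
          have := D.hnat
          rw [← hφ, hφχ, Polynomial.natDegree_mul (Polynomial.X_sub_C_ne_zero _)
            (mul_ne_zero (Polynomial.X_sub_C_ne_zero _) hχ0),
            Polynomial.natDegree_mul (Polynomial.X_sub_C_ne_zero _) hχ0] at this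
          simp at this
          omega
        have dz : (Polynomial.derivative φ).eval z = (z - w) * χ.eval z := by
          rw [hφχ]; simp
        have dw : (Polynomial.derivative φ).eval w = (w - z) * χ.eval w := by
          rw [hφχ]; simp
        have nz := D.dphi_ne hz
        have nw := D.dphi_ne hw
        rw [← hφ] at nz nw
        have h3 := h1 χ (by omega)
        rw [← Finset.add_sum_erase _ _ hz, ← Finset.add_sum_erase _ _
          (Finset.mem_erase.2 ⟨hzw.symm, hw⟩), Finset.sum_eq_zero, add_zero] at h3
        · rw [dz] at nz
          rw [dw] at nw
          have nz1 := right_ne_zero_of_mul nz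
          have nw1 := right_ne_zero_of_mul nw
          have nzw := left_ne_zero_of_mul nz
          have nwz := left_ne_zero_of_mul nw
          rw [dz, dw] at h3 ⊢
          have e : (w - z) = -(z - w) := by ring
          rw [e] at h3 ⊢
          field_simp at h3 ⊢
          linear_combination h3
        · intro y hy
          simp only [Finset.mem_erase] at hy
          have hy' := (D.mem_rts y).1 hy.2.2
          rw [← hφ, hφχ] at hy'
          simp only [Polynomial.eval_mul, Polynomial.eval_sub, Polynomial.eval_X, Polynomial.eval_C] at hy'
          have : χ.eval y = 0 := ((mul_eq_zero.1 ((mul_eq_zero.1 hy').resolve_left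
            (sub_ne_zero.2 hy.2.1))).resolve_left (sub_ne_zero.2 hy.1))
          rw [this]; simp
      obtain ⟨z0, hz0⟩ : (rts m f).Nonempty := by
        rw [← Finset.card_pos, D.card_rts]; omega
      set c := τ.eval z0 / (Polynomial.derivative φ).eval z0 with hc
      have hdφ : (Polynomial.derivative φ).natDegree = m + 1 := by
        have := D.hdeg; rwa [D.hTa] at this
      have hτd : τ.natDegree ≤ d := natDegree_T _ _
      have h3 : τ - Polynomial.C c * Polynomial.derivative φ = 0 := by
        apply Polynomial.eq_zero_of_natDegree_lt_card_of_eval_eq_zero' _ (rts m f)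
        · intro z hz
          have nz := D.dphi_ne hz
          have : τ.eval z / (Polynomial.derivative φ).eval z = c := by
            by_cases hzz : z = z0
            · rw [hzz]
            · exact h2 z hz z0 hz0 hzz
          rw [← this]
          simp only [Polynomial.eval_sub, Polynomial.eval_mul, Polynomial.eval_C]
          rw [← hφ] at nz
          field_simp
          ring
        · rw [D.card_rts]
          refine (Polynomial.natDegree_sub_le _ _).trans_lt ?_
          have := Polynomial.natDegree_C_mul_le c (Polynomial.derivative φ)
          rw [max_lt_iff]; omega
      by_cases hc0 : c = 0
      · rw [hc0] at h3; simpa using h3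
      · exfalso
        have h4 := sub_eq_zero.1 h3
        have := congrArg Polynomial.natDegree h4
        rw [Polynomial.natDegree_C_mul hc0, hdφ] at this
        omega
  exact key (m + 1) le_rfl hg

theorem Dat.exZ (D : Dat k m f) (L : BB f →ₗ[ℂ] ℂ)
    (hL : ∀ g ∈ RL (m + m + 1), L (Ideal.Quotient.mk _ g) = ell m f g) :
    ∃ Z : Submodule ℂ (BB f), (∀ u ∈ Z, (L (u * D.sB u)).re ≤ 0) ∧
      (∀ z ∈ Z, (∀ v, (L (z * D.sB v) + L (v * D.sB z)).re = 0) → z = 0) ∧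
      (m + 1) * (m + 2) / 2 ≤ Module.finrank ℂ Z + k := by
  classical
  let up := (rts m f).filter fun z => 0 < z.im
  let dφ := Polynomial.derivative (T (m + 2) f)
  let γ : ℂ → R2 →ₗ[ℂ] ℂ := fun z => (dφ.eval z)⁻¹ • ((Polynomial.leval z).comp (T m))
  have hγ : ∀ z g, γ z g = (dφ.eval z)⁻¹ * (T m g).eval z := fun z g => rfl
  let Ψ : RL (m + 1) →ₗ[ℂ] (up → ℂ) := LinearMap.pi fun z =>
    (γ z.1 - γ (starRingEnd ℂ z.1)).comp (RL (m + 1)).subtype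
  let q : RL (m + 1) →ₗ[ℂ] BB f := (Ideal.Quotient.mkₐ ℂ (JI f)).toLinearMap.comp (RL (m + 1)).subtype
  have hq : ∀ g, q g = Ideal.Quotient.mk (JI f) g.1 := fun g => rfl
  have hqi : Function.Injective q := by
    rw [← LinearMap.ker_eq_bot, LinearMap.ker_eq_bot']
    intro g hg
    apply Subtype.ext
    exact ideal_RL_zero D.ha D.hb D.hcop D.hdeg D.hne _ (Ideal.Quotient.eq_zero_iff_mem.1 hg) g.2
  refine ⟨(LinearMap.ker Ψ).map q, ?_, ?_, ?_⟩
  · rintro _ ⟨g, hg, rfl⟩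
    have h1 : ∀ z ∈ rts m f, γ z g.1 = γ (starRingEnd ℂ z) g.1 := by
      have h0 : ∀ z ∈ up, γ z g.1 = γ (starRingEnd ℂ z) g.1 := by
        intro z hz
        have : Ψ g = 0 := hg
        have := congrFun this ⟨z, hz⟩
        exact sub_eq_zero.1 this
      intro z hz
      rcases lt_or_gt_of_ne (D.im_rts hz) with h | h
      · have := h0 (starRingEnd ℂ z) (Finset.mem_filter.2 ⟨D.conj_rts hz, by simpa using h⟩)
        rw [Complex.conj_conj] at this
        exact this.symm
      · exact h0 z (Finset.mem_filter.2 ⟨hz, h⟩)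
    rw [hq, D.sB_mk, ← map_mul, hL _ (mul_mem_RL g.2 (sg_RL g.2)), ell_apply,
      T_mul g.2 (sg_RL g.2)]
    rw [Complex.neg_re, neg_nonpos, Complex.re_sum]
    refine Finset.sum_nonneg fun z hz => ?_
    have h2 : (T m g.1 * T m (sg g.1)).eval z / dφ.eval z ^ 2
        = γ z g.1 * starRingEnd ℂ (γ (starRingEnd ℂ z) g.1) := by
      have nz : dφ.eval z ≠ 0 := D.dphi_ne hz
      rw [hγ, hγ, Polynomial.eval_mul, eval_T_sg, map_mul, map_inv₀]
      have := D.conj_dphi z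
      change dφ.eval _ = _ at this
      rw [this, Complex.conj_conj]
      change _ = (dφ.eval z)⁻¹ * _ * ((dφ.eval z)⁻¹ * _)
      field_simp
    change 0 ≤ ((T m g.1 * T m (sg g.1)).eval z / dφ.eval z ^ 2).re
    rw [h2, ← h1 z hz, Complex.mul_conj, Complex.ofReal_re]
    exact Complex.normSq_nonneg _
  · rintro _ ⟨g, hg, rfl⟩ hv
    suffices g = 0 by rw [this, map_zero]
    apply Subtype.ext
    apply D.radZ g.1 g.2
    intro d hd hgd x hx
    have key : ∀ x ∈ RL (m + m - d + 1), (ell m f (g.1 * x)).re = 0 := by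
      intro x hx
      have h1 := hv (Ideal.Quotient.mk _ (sg x))
      have h2 : g.1 * x ∈ RL (m + m + 1) := by
        have := mul_mem_RL hgd hx
        rwa [show d + (m + m - d) = m + m by omega] at this
      have h3 : sg x * sg g.1 = sg (g.1 * x) := by rw [map_mul, mul_comm]
      rw [hq, D.sB_mk, D.sB_mk, sg_sg, ← map_mul, ← map_mul, h3, hL _ h2, hL _ (sg_RL h2),
        D.ell_sg, Complex.add_re, Complex.conj_re] at h1
      linarith
    have k1 := key x hx
    have k2 := key (Complex.I • x) (Submodule.smul_mem _ _ hx)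
    rw [mul_smul_comm, map_smul, smul_eq_mul, Complex.I_mul_re] at k2
    exact Complex.ext k1 (by simpa using k2)
  · have h1 := LinearMap.finrank_range_add_finrank_ker Ψ
    rw [(RL_fin (m + 1)).2] at h1
    have h2 : Module.finrank ℂ (LinearMap.range Ψ) ≤ up.card := by
      refine (Submodule.finrank_le _).trans ?_
      simp
    have h3 : up.card + up.card ≤ m + 2 := by
      have hinj : (up.image (starRingEnd ℂ)).card = up.card :=
        Finset.card_image_of_injective _ (starRingEnd ℂ).injective
      rw [← D.card_rts]
      nth_rw 2 [← hinj]
      rw [← Finset.card_union_of_disjoint]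
      · apply Finset.card_le_card
        intro z hz
        rcases Finset.mem_union.1 hz with hz | hz
        · exact (Finset.mem_filter.1 hz).1
        · obtain ⟨w, hw, rfl⟩ := Finset.mem_image.1 hz
          exact D.conj_rts (Finset.mem_filter.1 hw).1
      · rw [Finset.disjoint_left]
        intro z hz hz'
        obtain ⟨w, hw, rfl⟩ := Finset.mem_image.1 hz'
        have a1 := (Finset.mem_filter.1 hz).2
        have a2 := (Finset.mem_filter.1 hw).2
        rw [Complex.conj_im] at a1
        linarith
    have h4 : Module.finrank ℂ ((LinearMap.ker Ψ).map q) = Module.finrank ℂ (LinearMap.ker Ψ) :=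
      (Submodule.equivMapOfInjective q hqi _).finrank_eq.symm
    rw [h4]
    have hm := D.hm
    have : (m + 1) * (m + 1 + 1) = (m + 1) * (m + 2) := by ring
    rw [this] at h1
    omega

theorem Dat.core (D : Dat k m f) : (Nod f).Finite ∧
    {q ∈ Nod f | cj q = q}.ncard + (Nod f).ncard ≤ 3 * k ^ 2 - 3 * k + 2 := by
  classical
  refine ⟨D.nod_fin, ?_⟩
  set N := D.nod_fin.toFinset with hN
  have hNm : ∀ p, p ∈ N ↔ p ∈ Nod f := by simp [hN]
  let S := N.filter fun p => cj p = p ∨ Pos p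
  obtain ⟨L, hL⟩ := D.exists_L
  obtain ⟨U, hU1, hU2⟩ := D.exU L hL S (fun p hp => (hNm p).1 (Finset.mem_filter.1 hp).1) (by
    intro p hp hp'
    have h1 := (Finset.mem_filter.1 hp).2
    have h2 := (Finset.mem_filter.1 hp').2
    rcases h1 with h1 | h1
    · exact h1
    · rcases h2 with h2 | h2
      · rw [cj_cj] at h2; exact h2.symm
      · exact absurd h2 h1.not_cj)
  obtain ⟨Z, hZ1, hZ2, hZ3⟩ := D.exZ L hL
  have key := D.herm_dim L U Z hU1 hZ1 hZ2
  have hinj : Function.Injective cj := fun p q h => by rw [← cj_cj p, h, cj_cj]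
  have hun : S ∪ S.image cj = N := by
    ext p
    simp only [Finset.mem_union, Finset.mem_image, S, Finset.mem_filter]
    constructor
    · rintro (h | ⟨q, h, rfl⟩)
      · exact h.1
      · exact (hNm _).2 (cj_nod D ((hNm _).1 h.1))
    · intro hp
      by_cases h1 : cj p = p
      · exact Or.inl ⟨hp, Or.inl h1⟩
      · by_cases h2 : Pos p
        · exact Or.inl ⟨hp, Or.inr h2⟩
        · exact Or.inr ⟨cj p, ⟨(hNm _).2 (cj_nod D ((hNm _).1 hp)), Or.inr (pos_or p h1 h2)⟩, cj_cj p⟩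
  have hinter : S ∩ S.image cj = N.filter fun p => cj p = p := by
    ext p
    simp only [Finset.mem_inter, Finset.mem_image, S, Finset.mem_filter]
    constructor
    · rintro ⟨⟨h1, h2⟩, q, ⟨h3, h4⟩, rfl⟩
      refine ⟨h1, ?_⟩
      rcases h2 with h2 | h2
      · exact h2
      · rcases h4 with h4 | h4
        · rw [h4, h4]
        · exact absurd h2 h4.not_cj
    · rintro ⟨h1, h2⟩
      exact ⟨⟨h1, Or.inl h2⟩, p, ⟨h1, Or.inl h2⟩, h2⟩
  have hc := Finset.card_union_add_card_inter S (S.image cj)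
  rw [hun, hinter, Finset.card_image_of_injective _ hinj] at hc
  have e1 : (Nod f).ncard = N.card := Set.ncard_eq_toFinset_card _ D.nod_fin
  have e2 : {q ∈ Nod f | cj q = q}.ncard = (N.filter fun p => cj p = p).card := by
    rw [← Set.ncard_coe_finset]
    congr 1
    ext p; simp [hNm]
  rw [e1, e2]
  obtain ⟨j, hj⟩ : ∃ j, k = j + 1 := ⟨k - 1, by have := D.hm; omega⟩
  have hm : m = 2 * j := by have := D.hm; omega
  subst hj hm
  have q1 : (2 * j + 1) * (2 * j + 2) / 2 = (2 * j + 1) * (j + 1) := by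
    rw [show (2 * j + 1) * (2 * j + 2) = (2 * j + 1) * (j + 1) * 2 by ring]; simp
  have q2 : 2 * ((j + 1 - 1) * (j + 1) / 2) = j * (j + 1) := by
    rw [Nat.add_sub_cancel]
    exact Nat.mul_div_cancel' (Nat.even_mul_succ_self j).two_dvd
  rw [q1] at hZ3
  have q3 : 3 * (j + 1) ^ 2 - 3 * (j + 1) + 2 = 3 * (j * j) + 3 * j + 2 := by
    have : 3 * (j + 1) ^ 2 = 3 * (j * j) + 3 * j + 3 * (j + 1) := by ring
    omega
  rw [q3]
  nlinarith

end
end FC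

end


section
namespace FC

theorem hom_sub {R S : Type*} [CommRing R] [CommRing S] [Algebra R S] (Q : MvPolynomial (Fin 3) R)
    (d : ℕ) (h : Q.IsHomogeneous d) (a b : Fin 3 → S) :
    (aeval (fun i => Polynomial.C (a i) + Polynomial.C (b i) * Polynomial.X) Q :
      Polynomial S).natDegree ≤ d ∧
    (aeval (fun i => Polynomial.C (a i) + Polynomial.C (b i) * Polynomial.X) Q :
      Polynomial S).coeff d = aeval b Q := by
  have key : ∀ s ∈ Q.support, (aeval (fun i => Polynomial.C (a i) + Polynomial.C (b i) * Polynomial.X)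
        (monomial s (coeff s Q)) : Polynomial S).natDegree ≤ d ∧
      (aeval (fun i => Polynomial.C (a i) + Polynomial.C (b i) * Polynomial.X)
        (monomial s (coeff s Q)) : Polynomial S).coeff d = aeval b (monomial s (coeff s Q)) := by
    intro s hs
    have hd : s 0 + s 1 + s 2 = d := by
      have := h (mem_support_iff.1 hs)
      rw [← this, Finsupp.weight_apply, Finsupp.sum_fintype _ _ (by simp), Fin.sum_univ_three]
      simp
    rw [aeval_monomial, aeval_monomial, Finsupp.prod_fintype _ _ (by simp),
      Finsupp.prod_fintype _ _ (by simp), Fin.prod_univ_three, Fin.prod_univ_three,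
      Polynomial.algebraMap_apply]
    have h1 : ∀ i, (Polynomial.C (a i) + Polynomial.C (b i) * Polynomial.X).natDegree ≤ 1 := by
      intro i; compute_degree
    have h2 : ∀ i n, ((Polynomial.C (a i) + Polynomial.C (b i) * Polynomial.X) ^ n).natDegree ≤ n := by
      intro i n
      refine (Polynomial.natDegree_pow_le_of_le n (h1 i)).trans (by omega)
    have h3 : ∀ i n, ((Polynomial.C (a i) + Polynomial.C (b i) * Polynomial.X) ^ n).coeff n = b i ^ n := by
      intro i n
      have := Polynomial.coeff_pow_of_natDegree_le (m := n) (h1 i)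
      rw [mul_one] at this
      rw [this]; simp
    have h4 := Polynomial.natDegree_mul_le_of_le (h2 0 (s 0)) (h2 1 (s 1))
    have h5 := Polynomial.natDegree_mul_le_of_le h4 (h2 2 (s 2))
    refine ⟨(Polynomial.natDegree_C_mul_le _ _).trans (h5.trans hd.le), ?_⟩
    rw [Polynomial.coeff_C_mul, ← hd, Polynomial.coeff_mul_add_eq_of_natDegree_le h4 (h2 2 (s 2)),
      Polynomial.coeff_mul_add_eq_of_natDegree_le (h2 0 (s 0)) (h2 1 (s 1)), h3, h3, h3]
  rw [Q.as_sum]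
  simp only [map_sum, Polynomial.finsetSum_coeff]
  refine ⟨Polynomial.natDegree_sum_le_of_forall_le _ _ fun s hs => (key s hs).1,
    Finset.sum_congr rfl fun s hs => (key s hs).2⟩

theorem chain {R B : Type*} [CommRing R] [CommRing B] [Algebra R B] (D : Derivation R B B)
    (g : Fin 3 → B) (Q : MvPolynomial (Fin 3) R) :
    D (aeval g Q) = ∑ i, aeval g (pderiv i Q) * D (g i) := by
  classical
  induction Q using MvPolynomial.induction_on with
  | C a => simp
  | add p q hp hq => simp only [map_add, hp, hq, add_mul, Finset.sum_add_distrib]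
  | mul_X p i hp =>
    simp only [map_mul, Derivation.leibniz, aeval_X, hp, smul_eq_mul, map_add, add_mul,
      Finset.sum_add_distrib, Finset.mul_sum, pderiv_X]
    congr 1
    · rw [Finset.sum_eq_single i]
      · simp
      · intro j _ hj; simp [Pi.single_eq_of_ne' hj]
      · simp
    · exact Finset.sum_congr rfl fun j _ => by ring

theorem euler {K : Type*} [CommRing K] {d : ℕ} (Q : MvPolynomial (Fin 3) K) (h : Q.IsHomogeneous d)
    (z : Fin 3 → K) : ∑ i, z i * eval z (pderiv i Q) = d * eval z Q := by
  have := congrArg (eval z) h.sum_X_mul_pderiv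
  simpa using this

theorem generic_sep (Q : MvPolynomial (Fin 3) ℂ) (d : ℕ) (hom : Q.IsHomogeneous d)
    (sf : Squarefree Q) (v0 : Fin 3 → ℂ) (h0 : eval v0 Q ≠ 0) :
    ∃ D : MvPolynomial (Fin 3) ℂ, D ≠ 0 ∧ ∀ v1 : Fin 3 → ℂ, eval v1 D ≠ 0 →
      (aeval (fun i => Polynomial.C (v1 i) + Polynomial.C (v0 i) * Polynomial.X) Q :
        Polynomial ℂ).Separable := by
  let A := MvPolynomial (Fin 3) ℂ
  let θ : (Fin 3 → ℂ) → (Polynomial A →+* Polynomial A) := fun v =>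
    Polynomial.eval₂RingHom (aeval (fun i => Polynomial.C (X i : A) + Polynomial.C (C (v i) : A)
      * Polynomial.X) : A →ₐ[ℂ] Polynomial A).toRingHom Polynomial.X
  have hθX : ∀ v, θ v Polynomial.X = Polynomial.X := by intro v; simp [θ]
  have hθC : ∀ v g, θ v (Polynomial.C g) = aeval (fun i => Polynomial.C (X i : A) + Polynomial.C (C (v i) : A)
      * Polynomial.X) g := by intro v g; simp [θ]
  have hθθ : ∀ v x, θ v (θ (-v) x) = x := by
    intro v x
    suffices h : (θ v).comp (θ (-v)) = RingHom.id _ from RingHom.congr_fun h x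
    apply Polynomial.ringHom_ext'
    · apply MvPolynomial.ringHom_ext
      · intro r
        simp only [RingHom.comp_apply, hθC, RingHom.id_apply, aeval_C]
        rw [Polynomial.algebraMap_apply, hθC]
        exact AlgHom.commutes _ r
      · intro i
        simp only [RingHom.comp_apply, hθC, RingHom.id_apply, aeval_X, map_add, map_mul, hθX]
        rw [show (C ((-v) i) : A) = algebraMap ℂ A ((-v) i) from rfl, AlgHom.commutes,
          Polynomial.algebraMap_apply]
        simp only [Pi.neg_apply, map_neg]
        rw [show algebraMap ℂ A (v i) = C (v i) from rfl]; ring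
    · simp only [RingHom.comp_apply, hθX, RingHom.id_apply]
  set Φ : Polynomial A := θ v0 (Polynomial.C Q) with hΦ
  have hsfC : Squarefree (Polynomial.C Q) := by
    intro x hx
    have hQ0 : Polynomial.C Q ≠ 0 := by
      rw [Ne, Polynomial.C_eq_zero]; exact sf.ne_zero
    have hdvd : x ∣ Polynomial.C Q := (dvd_mul_right x x).trans hx
    have h1 : x.natDegree = 0 := by
      have := Polynomial.natDegree_le_of_dvd hdvd hQ0
      simpa using this
    rw [Polynomial.eq_C_of_natDegree_eq_zero h1] at hx ⊢
    rw [← Polynomial.C_mul, Polynomial.C_dvd_iff_dvd_coeff] at hx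
    have := hx 0
    rw [Polynomial.coeff_C_zero] at this
    exact (sf _ this).map Polynomial.C
  have hsfΦ : Squarefree Φ := by
    intro x hx
    have h1 := map_dvd (θ (-v0)) hx
    have h2 : θ (-v0) Φ = Polynomial.C Q := by
      have := hθθ (-v0) (Polynomial.C Q); rwa [neg_neg] at this
    rw [h2, map_mul] at h1
    have := (hsfC _ h1).map (θ v0)
    rwa [hθθ] at this
  have hΦd := hom_sub (S := A) Q d hom (fun i => X i) (fun i => C (v0 i))
  rw [← hθC, ← hΦ] at hΦd
  have hlead : aeval (fun i => (C (v0 i) : A)) Q = C (eval v0 Q) := by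
    have := (MvPolynomial.aeval_algebraMap_apply (B := A) v0 Q)
    rw [aeval_eq_eval] at this
    exact this
  rw [hlead] at hΦd
  set c := eval v0 Q with hc
  obtain ⟨Φ1, hΦ1⟩ : ∃ x : Polynomial A, x = Polynomial.C (C c⁻¹) * Φ := ⟨_, rfl⟩
  have hunit : IsUnit (Polynomial.C (C c⁻¹ : A)) :=
    ((isUnit_iff_ne_zero.2 (inv_ne_zero h0)).map (C : ℂ →+* A)).map Polynomial.C
  have hmon : Φ1.Monic := by
    apply Polynomial.monic_of_natDegree_le_of_coeff_eq_one d
    · rw [hΦ1]; exact (Polynomial.natDegree_C_mul_le _ _).trans hΦd.1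
    · rw [hΦ1, Polynomial.coeff_C_mul, hΦd.2, ← C_mul, inv_mul_cancel₀ h0, C_1]
  have hsf1 : Squarefree Φ1 := by
    intro x hx
    rw [hΦ1] at hx
    exact hsfΦ x ((hunit.dvd_mul_left).1 hx)
  let F := FractionRing A
  have hinj : Function.Injective (algebraMap A F) := IsFractionRing.injective A F
  have hsfF : Squarefree (Φ1.map (algebraMap A F)) := by
    intro x hx
    have hdvd : x ∣ Φ1.map (algebraMap A F) := (dvd_mul_right x x).trans hx
    have hx0 : x ≠ 0 := by
      rintro rfl
      rw [zero_dvd_iff] at hdvd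
      exact (hmon.map (algebraMap A F)).ne_zero hdvd
    obtain ⟨g, hg⟩ := IsIntegrallyClosed.eq_map_mul_C_of_dvd F hmon hdvd
    have hl : x.leadingCoeff ≠ 0 := Polynomial.leadingCoeff_ne_zero.2 hx0
    have hgm : g.Monic := by
      apply Polynomial.monic_of_injective hinj
      have := congrArg Polynomial.leadingCoeff hg
      rw [Polynomial.leadingCoeff_mul, Polynomial.leadingCoeff_C] at this
      exact mul_right_cancel₀ hl (by rw [this, one_mul])
    have h1 : (g * g).map (algebraMap A F) ∣ Φ1.map (algebraMap A F) := by
      refine dvd_trans ?_ hx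
      rw [Polynomial.map_mul]
      exact mul_dvd_mul ⟨_, hg.symm⟩ ⟨_, hg.symm⟩
    rw [Polynomial.map_dvd_map _ hinj (hgm.mul hgm)] at h1
    have := (hsf1 _ h1).map (Polynomial.mapRingHom (algebraMap A F))
    rw [← hg]
    exact this.mul (Polynomial.isUnit_C.2 (isUnit_iff_ne_zero.2 hl))
  have : CharZero F := charZero_of_injective_algebraMap (R := ℂ) (FaithfulSMul.algebraMap_injective ℂ F)
  have hsep : (Φ1.map (algebraMap A F)).Separable := PerfectField.separable_iff_squarefree.2 hsfF
  obtain ⟨u, v, huv⟩ := hsep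
  obtain ⟨b1, hb1⟩ := IsLocalization.integerNormalization_map_to_map (nonZeroDivisors A) u
  obtain ⟨b2, hb2⟩ := IsLocalization.integerNormalization_map_to_map (nonZeroDivisors A) v
  set U := IsLocalization.integerNormalization (nonZeroDivisors A) u
  set V := IsLocalization.integerNormalization (nonZeroDivisors A) v
  have hfin : Polynomial.C (b2 : A) * U * Φ1 + Polynomial.C (b1 : A) * V * Polynomial.derivative Φ1
      = Polynomial.C ((b1 : A) * b2) := by
    apply Polynomial.map_injective _ hinj
    simp only [Polynomial.map_add, Polynomial.map_mul, hb1, hb2, ← Polynomial.derivative_map,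
      Polynomial.map_C, map_mul, Algebra.smul_def, Polynomial.algebraMap_apply]
    linear_combination Polynomial.C (algebraMap A F b1) * Polynomial.C (algebraMap A F b2) * huv
  refine ⟨(b1 : A) * b2, mul_ne_zero (nonZeroDivisors.coe_ne_zero b1) (nonZeroDivisors.coe_ne_zero b2), ?_⟩
  intro v1 hv1
  have hspec : Φ.map (eval v1 : A →+* ℂ) =
      aeval (fun i => Polynomial.C (v1 i) + Polynomial.C (v0 i) * Polynomial.X) Q := by
    rw [hΦ, hθC]
    have : ((Polynomial.mapRingHom (eval v1 : A →+* ℂ)).comp (aeval (fun i => Polynomial.C (X i : A) + Polynomial.C (C (v0 i) : A)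
      * Polynomial.X) : A →ₐ[ℂ] Polynomial A).toRingHom) = (aeval (fun i => Polynomial.C (v1 i) + Polynomial.C (v0 i) * Polynomial.X) : A →ₐ[ℂ] Polynomial ℂ).toRingHom := by
      apply MvPolynomial.ringHom_ext
      · intro r
        simp [Polynomial.algebraMap_apply]
        exact eval_C r
      · intro i; simp
    exact RingHom.congr_fun this Q
  rw [← hspec]
  have h2 := congrArg (Polynomial.map (eval v1 : A →+* ℂ)) hfin
  set W := Φ.map (eval v1 : A →+* ℂ) with hW
  have h3 : Φ1.map (eval v1 : A →+* ℂ) = Polynomial.C c⁻¹ * W := by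
    rw [hΦ1, Polynomial.map_mul, Polynomial.map_C, eval_C]
  rw [Polynomial.map_add, Polynomial.map_mul, Polynomial.map_mul, Polynomial.map_mul, Polynomial.map_mul,
    ← Polynomial.derivative_map, h3, Polynomial.derivative_C_mul] at h2
  simp only [Polynomial.map_C] at h2
  set e := eval v1 ((b1 : A) * b2) with he
  have h4 : Polynomial.C e⁻¹ * Polynomial.C e = 1 := by
    rw [← Polynomial.C_mul, inv_mul_cancel₀ hv1, Polynomial.C_1]
  refine ⟨Polynomial.C e⁻¹ * (Polynomial.C (eval v1 (b2 : A)) * U.map (eval v1 : A →+* ℂ) * Polynomial.C c⁻¹),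
    Polynomial.C e⁻¹ * (Polynomial.C (eval v1 (b1 : A)) * V.map (eval v1 : A →+* ℂ) * Polynomial.C c⁻¹), ?_⟩
  linear_combination Polynomial.C e⁻¹ * h2 + h4

end FC

end


section
namespace FC

theorem pderiv_swap {R : Type*} [CommRing R] (i j : Fin 3) (Q : MvPolynomial (Fin 3) R) :
    pderiv i (pderiv j Q) = pderiv j (pderiv i Q) := by
  have h : ⁅(pderiv i : Derivation R (MvPolynomial (Fin 3) R) (MvPolynomial (Fin 3) R)), (pderiv j : Derivation R (MvPolynomial (Fin 3) R) (MvPolynomial (Fin 3) R))⁆ = 0 := by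
    apply MvPolynomial.derivation_ext
    intro l
    rw [Derivation.commutator_apply, pderiv_X, pderiv_X]
    rcases eq_or_ne l i with rfl | h1 <;> rcases eq_or_ne l j with rfl | h2 <;> simp [Pi.single_apply, *]
  have := Derivation.congr_fun h Q
  rw [Derivation.commutator_apply] at this
  exact sub_eq_zero.1 this

theorem eval_scale {K : Type*} [CommRing K] {d : ℕ} (Q : MvPolynomial (Fin 3) K) (h : Q.IsHomogeneous d)
    (c : K) (z : Fin 3 → K) : eval (fun i => c * z i) Q = c ^ d * eval z Q := by
  rw [eval_eq, eval_eq, Finset.mul_sum]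
  refine Finset.sum_congr rfl fun s hs => ?_
  have hd : s 0 + s 1 + s 2 = d := by
    have := h (mem_support_iff.1 hs)
    rw [← this, Finsupp.weight_apply, Finsupp.sum_fintype _ _ (by simp), Fin.sum_univ_three]
    simp
  have : ∀ (w : Fin 3 → K), ∏ i ∈ s.support, w i ^ s i = ∏ i, w i ^ s i := by
    intro w
    refine Finset.prod_subset (Finset.subset_univ _) fun i _ hi => ?_
    rw [Finsupp.notMem_support_iff.1 hi, pow_zero]
  rw [this, this, Fin.prod_univ_three, Fin.prod_univ_three, ← hd]
  ring

theorem eval_aeval {K σ : Type*} [CommRing K] (g : Fin 3 → MvPolynomial σ K) (q : σ → K)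
    (Q : MvPolynomial (Fin 3) K) : eval q (aeval g Q) = eval (fun i => eval q (g i)) Q := by
  induction Q using MvPolynomial.induction_on with
  | C a => simp
  | add p q hp hq => simp only [map_add, hp, hq]
  | mul_X p i hp => simp only [map_mul, hp, aeval_X, eval_X]

theorem peval_aeval {K : Type*} [CommRing K] (g : Fin 3 → Polynomial K) (x : K)
    (Q : MvPolynomial (Fin 3) K) : (aeval g Q).eval x = eval (fun i => (g i).eval x) Q := by
  induction Q using MvPolynomial.induction_on with
  | C a => simp
  | add p q hp hq => simp only [map_add, Polynomial.eval_add, hp, hq]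
  | mul_X p i hp => simp only [map_mul, Polynomial.eval_mul, hp, aeval_X, eval_X]

theorem eval_map_real (P : MvPolynomial (Fin 3) ℝ) (z : Fin 3 → ℝ) :
    eval (fun i => (z i : ℂ)) (map (algebraMap ℝ ℂ) P) = ((eval z P : ℝ) : ℂ) := by
  rw [eval_map]
  exact (eval₂_comp_left (algebraMap ℝ ℂ) (RingHom.id ℝ) z P).symm

def det3 {K : Type*} [CommRing K] (a b c : Fin 3 → K) : K :=
  a 0 * (b 1 * c 2 - b 2 * c 1) - a 1 * (b 0 * c 2 - b 2 * c 0) + a 2 * (b 0 * c 1 - b 1 * c 0)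

theorem cramer {K : Type*} [CommRing K] (a b c z : Fin 3 → K) (i : Fin 3) :
    det3 a b c * z i = det3 z b c * a i + det3 a z c * b i + det3 a b z * c i := by
  fin_cases i <;> simp [det3] <;> ring

/-- coordinates -/
theorem coords {K : Type*} [Field K] (a b c : Fin 3 → K) (h : det3 a b c ≠ 0) (z : Fin 3 → K) :
    ∃ x y w : K, ∀ i, z i = x * a i + y * b i + w * c i := by
  refine ⟨det3 z b c / det3 a b c, det3 a z c / det3 a b c, det3 a b z / det3 a b c, fun i => ?_⟩
  have := cramer a b c z i
  field_simp
  linear_combination this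

theorem indep {K : Type*} [Field K] (a b c : Fin 3 → K) (h : det3 a b c ≠ 0) (x y w : K)
    (hz : ∀ i, x * a i + y * b i + w * c i = 0) : x = 0 ∧ y = 0 ∧ w = 0 := by
  have h0 := hz 0
  have h1 := hz 1
  have h2 := hz 2
  refine ⟨?_, ?_, ?_⟩
  · refine (mul_eq_zero.1 (?_ : x * det3 a b c = 0)).resolve_right h
    simp only [det3]
    linear_combination (b 1 * c 2 - b 2 * c 1) * h0 - (b 0 * c 2 - b 2 * c 0) * h1 + (b 0 * c 1 - b 1 * c 0) * h2
  · refine (mul_eq_zero.1 (?_ : y * det3 a b c = 0)).resolve_right h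
    simp only [det3]
    linear_combination (-(a 1 * c 2 - a 2 * c 1)) * h0 + (a 0 * c 2 - a 2 * c 0) * h1 - (a 0 * c 1 - a 1 * c 0) * h2
  · refine (mul_eq_zero.1 (?_ : w * det3 a b c = 0)).resolve_right h
    simp only [det3]
    linear_combination (a 1 * b 2 - a 2 * b 1) * h0 - (a 0 * b 2 - a 2 * b 0) * h1 + (a 0 * b 1 - a 1 * b 0) * h2

/-- kernel form of the node condition -/
def KNode (Q : MvPolynomial (Fin 3) ℂ) : Prop :=
  ∀ z : Fin 3 → ℂ, z ≠ 0 → (∀ i, eval z (pderiv i Q) = 0) → ∀ u : Fin 3 → ℂ,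
    (∀ i, ∑ j, eval z (pderiv i (pderiv j Q)) * u j = 0) → ∃ c : ℂ, ∀ i, u i = c * z i

theorem knode_of_rank (Q : MvPolynomial (Fin 3) ℂ) (d : ℕ) (hom : Q.IsHomogeneous d)
    (h : ∀ x ∈ SingSet Q, IsNodeAt Q x) : KNode Q := by
  intro z hz hg u hu
  obtain ⟨a, ha⟩ := Projectivization.exists_smul_eq_mk_rep ℂ z hz
  have ha' : (Projectivization.mk ℂ z hz).rep = fun i => (a : ℂ) * z i := by
    rw [← ha]; rfl
  have hmem : Projectivization.mk ℂ z hz ∈ SingSet Q := by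
    intro i
    rw [ha', eval_scale _ hom.pderiv, hg, mul_zero]
  have hn := h _ hmem
  unfold IsNodeAt at hn
  rw [ha'] at hn
  set H := (Matrix.of fun i j : Fin 3 => eval (fun i => (a : ℂ) * z i) (pderiv i (pderiv j Q))) with hH
  have hHij : ∀ i j, H i j = (a : ℂ) ^ (d - 1 - 1) * eval z (pderiv i (pderiv j Q)) := by
    intro i j
    rw [hH, Matrix.of_apply, eval_scale _ hom.pderiv.pderiv]
  have hker : ∀ w : Fin 3 → ℂ, (∀ i, ∑ j, eval z (pderiv i (pderiv j Q)) * w j = 0) →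
      w ∈ LinearMap.ker H.mulVecLin := by
    intro w hw
    rw [LinearMap.mem_ker, Matrix.mulVecLin_apply]
    funext i
    simp only [Matrix.mulVec, dotProduct, hHij, mul_assoc, ← Finset.mul_sum, hw, mul_zero, Pi.zero_apply]
  have hzk : z ∈ LinearMap.ker H.mulVecLin := by
    apply hker
    intro i
    have := euler (pderiv i Q) hom.pderiv z
    rw [hg, mul_zero] at this
    rw [← this]
    exact Finset.sum_congr rfl fun j _ => by rw [pderiv_swap, mul_comm]
  have hrk := H.mulVecLin.finrank_range_add_finrank_ker
  have h1 : Module.finrank ℂ (LinearMap.ker H.mulVecLin) = 1 := by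
    have h2 : Module.finrank ℂ (LinearMap.range H.mulVecLin) = 2 := hn
    rw [h2] at hrk
    simp at hrk
    omega
  obtain ⟨c, hc⟩ := exists_smul_eq_of_finrank_eq_one h1 (x := ⟨z, hzk⟩)
    (by intro h0; exact hz (congrArg Subtype.val h0)) ⟨u, hker u hu⟩
  refine ⟨c, fun i => ?_⟩
  have := congrFun (congrArg Subtype.val hc) i
  simpa using this.symm

end FC

end


section
set_option linter.unusedSimpArgs false
namespace FC

/-- complexification -/
noncomputable abbrev cx (P : MvPolynomial (Fin 3) ℝ) : MvPolynomial (Fin 3) ℂ :=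
  MvPolynomial.map (algebraMap ℝ ℂ) P

structure Red (k : ℕ) (P : MvPolynomial (Fin 3) ℝ) (v0 v1 v2 : Fin 3 → ℝ) : Prop where
  hk : 1 ≤ k
  hom : P.IsHomogeneous (2 * k)
  det : det3 v0 v1 v2 ≠ 0
  P0 : eval v0 P ≠ 0
  sep : (aeval (fun i => Polynomial.C (v1 i : ℂ) + Polynomial.C (v0 i : ℂ) * Polynomial.X) (cx P) :
        Polynomial ℂ).Separable
  inf : ∀ α β : ℝ, eval (fun i => α * v0 i + β * v1 i) P = 0 → α = 0 ∧ β = 0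
  sgn : ∀ x y : ℝ, 0 ≤ eval (fun i => v2 i + v0 i * x + v1 i * y) P
  node : KNode (cx P)

namespace Red
variable {k : ℕ} {P : MvPolynomial (Fin 3) ℝ} {v0 v1 v2 : Fin 3 → ℝ}

noncomputable def ff (P : MvPolynomial (Fin 3) ℝ) (v0 v1 v2 : Fin 3 → ℝ) : R2 :=
  aeval (fun i => C (v2 i : ℂ) + C (v0 i : ℂ) * X 0 + C (v1 i : ℂ) * X 1) (cx P)

noncomputable def pt (v0 v1 v2 : Fin 3 → ℝ) (q : Fin 2 → ℂ) : Fin 3 → ℂ :=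
  fun i => (v2 i : ℂ) + (v0 i : ℂ) * q 0 + (v1 i : ℂ) * q 1

theorem eval_ff (q : Fin 2 → ℂ) : eval q (ff P v0 v1 v2) = eval (pt v0 v1 v2 q) (cx P) := by
  rw [ff, eval_aeval]
  simp [pt]
  rfl

theorem pd0 (g : MvPolynomial (Fin 3) ℂ) :
    pderiv 0 (aeval (fun i => C (v2 i : ℂ) + C (v0 i : ℂ) * X 0 + C (v1 i : ℂ) * X 1) g : R2) =
    ∑ i, aeval (fun i => C (v2 i : ℂ) + C (v0 i : ℂ) * X 0 + C (v1 i : ℂ) * X 1) (pderiv i g) * C (v0 i : ℂ) := by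
  rw [chain]
  simp

theorem pd1 (g : MvPolynomial (Fin 3) ℂ) :
    pderiv 1 (aeval (fun i => C (v2 i : ℂ) + C (v0 i : ℂ) * X 0 + C (v1 i : ℂ) * X 1) g : R2) =
    ∑ i, aeval (fun i => C (v2 i : ℂ) + C (v0 i : ℂ) * X 0 + C (v1 i : ℂ) * X 1) (pderiv i g) * C (v1 i : ℂ) := by
  rw [chain]
  simp

theorem ev (g : MvPolynomial (Fin 3) ℂ) (q : Fin 2 → ℂ) :
    eval q (aeval (fun i => C (v2 i : ℂ) + C (v0 i : ℂ) * X 0 + C (v1 i : ℂ) * X 1) g : R2) =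
      eval (pt v0 v1 v2 q) g := by
  rw [eval_aeval]
  simp [pt]
  rfl

theorem det_c (R : Red k P v0 v1 v2) :
    det3 (fun i => (v0 i : ℂ)) (fun i => (v1 i : ℂ)) (fun i => (v2 i : ℂ)) ≠ 0 := by
  have := R.det
  simp only [det3] at *
  exact_mod_cast this

theorem homc (R : Red k P v0 v1 v2) : (cx P).IsHomogeneous (2 * k) := R.hom.map _

theorem pt_ne (R : Red k P v0 v1 v2) (q : Fin 2 → ℂ) : pt v0 v1 v2 q ≠ 0 := by
  intro h
  have := (indep _ _ _ R.det_c (q 0) (q 1) 1 (fun i => by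
    have := congrFun h i
    simp only [pt, Pi.zero_apply] at this
    linear_combination this)).2.2
  exact one_ne_zero this

/-- a linear functional vanishing on `v0, v1, pt q` vanishes -/
theorem lin_zero (R : Red k P v0 v1 v2) (q : Fin 2 → ℂ) (c : Fin 3 → ℂ)
    (h0 : ∑ i, c i * (v0 i : ℂ) = 0) (h1 : ∑ i, c i * (v1 i : ℂ) = 0)
    (h2 : ∑ i, c i * pt v0 v1 v2 q i = 0) (i : Fin 3) : c i = 0 := by
  have h3 : ∑ i, c i * (v2 i : ℂ) = 0 := by
    simp only [Fin.sum_univ_three, pt] at *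
    linear_combination h2 - q 0 * h0 - q 1 * h1
  obtain ⟨x, y, w, hz⟩ := coords _ _ _ R.det_c (fun j => if j = i then 1 else 0)
  have h4 : ∑ j, c j * (if j = i then (1 : ℂ) else 0) = c i := by simp
  rw [← h4]
  simp only [hz]
  simp only [Fin.sum_univ_three] at *
  linear_combination x * h0 + y * h1 + w * h3

theorem nod_iff (R : Red k P v0 v1 v2) (q : Fin 2 → ℂ) :
    q ∈ Nod (ff P v0 v1 v2) ↔ ∀ i, eval (pt v0 v1 v2 q) (pderiv i (cx P)) = 0 := by
  have he := euler (cx P) R.homc (pt v0 v1 v2 q)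
  have hk := R.hk
  have e0 : eval q (pderiv 0 (ff P v0 v1 v2)) = ∑ i, eval (pt v0 v1 v2 q) (pderiv i (cx P)) * (v0 i : ℂ) := by
    rw [ff, pd0]; simp only [map_sum, map_mul, ev, eval_C]
  have e1 : eval q (pderiv 1 (ff P v0 v1 v2)) = ∑ i, eval (pt v0 v1 v2 q) (pderiv i (cx P)) * (v1 i : ℂ) := by
    rw [ff, pd1]; simp only [map_sum, map_mul, ev, eval_C]
  constructor
  · rintro ⟨h, h0, h1⟩
    rw [eval_ff] at h
    rw [h, mul_zero] at he
    refine R.lin_zero q _ (e0 ▸ h0) (e1 ▸ h1) ?_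
    rw [← he]
    exact Finset.sum_congr rfl fun j _ => mul_comm _ _
  · intro h
    simp only [h, mul_zero, Finset.sum_const_zero, zero_mul] at he e0 e1
    refine ⟨?_, e0, e1⟩
    rw [eval_ff]
    refine (mul_eq_zero.1 he.symm).resolve_left ?_
    have : 2 * k ≠ 0 := by omega
    exact_mod_cast this

theorem jac (R : Red k P v0 v1 v2) (q : Fin 2 → ℂ) (hq : q ∈ Nod (ff P v0 v1 v2)) :
    eval q (pderiv 0 (pderiv 0 (ff P v0 v1 v2))) * eval q (pderiv 1 (pderiv 1 (ff P v0 v1 v2)))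
      - eval q (pderiv 1 (pderiv 0 (ff P v0 v1 v2))) * eval q (pderiv 0 (pderiv 1 (ff P v0 v1 v2))) ≠ 0 := by
  intro hJ
  rw [R.nod_iff] at hq
  obtain ⟨H, hH⟩ : ∃ H : Fin 3 → Fin 3 → ℂ, ∀ i j, H i j = eval (pt v0 v1 v2 q) (pderiv i (pderiv j (cx P))) :=
    ⟨_, fun _ _ => rfl⟩
  have e00 : eval q (pderiv 0 (pderiv 0 (ff P v0 v1 v2))) =
      ∑ i, ∑ m, H m i * (v0 m : ℂ) * (v0 i : ℂ) := by
    rw [ff, pd0]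
    simp only [map_sum, Derivation.leibniz, pderiv_C, map_add, map_zero, mul_zero, zero_add, smul_eq_mul, pd0, map_mul,
      eval_C, ev, Finset.mul_sum, hH]
    exact Finset.sum_congr rfl fun i _ => Finset.sum_congr rfl fun j _ => by ring
  have e10 : eval q (pderiv 1 (pderiv 0 (ff P v0 v1 v2))) =
      ∑ i, ∑ m, H m i * (v1 m : ℂ) * (v0 i : ℂ) := by
    rw [ff, pd0]
    simp only [map_sum, Derivation.leibniz, pderiv_C, map_add, map_zero, mul_zero, zero_add, smul_eq_mul, pd1, map_mul,
      eval_C, ev, Finset.mul_sum, hH]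
    exact Finset.sum_congr rfl fun i _ => Finset.sum_congr rfl fun j _ => by ring
  have e01 : eval q (pderiv 0 (pderiv 1 (ff P v0 v1 v2))) =
      ∑ i, ∑ m, H m i * (v0 m : ℂ) * (v1 i : ℂ) := by
    rw [ff, pd1]
    simp only [map_sum, Derivation.leibniz, pderiv_C, map_add, map_zero, mul_zero, zero_add, smul_eq_mul, pd0, map_mul,
      eval_C, ev, Finset.mul_sum, hH]
    exact Finset.sum_congr rfl fun i _ => Finset.sum_congr rfl fun j _ => by ring
  have e11 : eval q (pderiv 1 (pderiv 1 (ff P v0 v1 v2))) =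
      ∑ i, ∑ m, H m i * (v1 m : ℂ) * (v1 i : ℂ) := by
    rw [ff, pd1]
    simp only [map_sum, Derivation.leibniz, pderiv_C, map_add, map_zero, mul_zero, zero_add, smul_eq_mul, pd1, map_mul,
      eval_C, ev, Finset.mul_sum, hH]
    exact Finset.sum_congr rfl fun i _ => Finset.sum_congr rfl fun j _ => by ring
  have eu : ∀ i, ∑ m, H m i * pt v0 v1 v2 q m = 0 := by
    intro i
    have := euler (pderiv i (cx P)) R.homc.pderiv (pt v0 v1 v2 q)
    rw [hq, mul_zero] at this
    rw [← this]
    exact Finset.sum_congr rfl fun j _ => by rw [hH, mul_comm]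
  set h00 := eval q (pderiv 0 (pderiv 0 (ff P v0 v1 v2)))
  set h10 := eval q (pderiv 1 (pderiv 0 (ff P v0 v1 v2)))
  set h01 := eval q (pderiv 0 (pderiv 1 (ff P v0 v1 v2)))
  set h11 := eval q (pderiv 1 (pderiv 1 (ff P v0 v1 v2)))
  obtain ⟨s, t, hst, hs0, hs1⟩ : ∃ s t : ℂ, (s ≠ 0 ∨ t ≠ 0) ∧ s * h00 + t * h01 = 0 ∧ s * h10 + t * h11 = 0 := by
    by_cases hA : h11 = 0 ∧ h10 = 0
    · by_cases hB : h00 = 0 ∧ h01 = 0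
      · exact ⟨1, 0, Or.inl one_ne_zero, by rw [hB.1]; ring, by rw [hA.2]; ring⟩
      · refine ⟨h01, -h00, ?_, by ring, by rw [hA.1, hA.2]; ring⟩
        by_contra hc
        push Not at hc
        exact hB ⟨neg_eq_zero.1 hc.2, hc.1⟩
    · refine ⟨h11, -h10, ?_, by linear_combination hJ, by ring⟩
      by_contra hc
      push Not at hc
      exact hA ⟨hc.1, neg_eq_zero.1 hc.2⟩
  have hu : ∀ m, ∑ j, H m j * (s * (v0 j : ℂ) + t * (v1 j : ℂ)) = 0 := by
    apply R.lin_zero q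
    · rw [← hs0, e00, e01]; simp only [Fin.sum_univ_three]; ring
    · rw [← hs1, e10, e11]; simp only [Fin.sum_univ_three]; ring
    · have E0 := eu 0
      have E1 := eu 1
      have E2 := eu 2
      simp only [Fin.sum_univ_three] at *
      linear_combination (s * (v0 0 : ℂ) + t * (v1 0 : ℂ)) * E0 + (s * (v0 1 : ℂ) + t * (v1 1 : ℂ)) * E1
        + (s * (v0 2 : ℂ) + t * (v1 2 : ℂ)) * E2
  obtain ⟨c, hc⟩ := R.node _ (R.pt_ne q) hq (fun j => s * (v0 j : ℂ) + t * (v1 j : ℂ))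
    (by simpa only [hH] using hu)
  have := indep _ _ _ R.det_c (s - c * q 0) (t - c * q 1) (-c) (fun i => by
    have := hc i
    simp only [pt] at this
    linear_combination this)
  obtain ⟨h1, h2, h3⟩ := this
  have hc0 : c = 0 := neg_eq_zero.1 h3
  rw [hc0, zero_mul, sub_zero] at h1 h2
  rcases hst with h | h
  · exact h h1
  · exact h h2

end Red
end FC

end


section
set_option linter.unusedSimpArgs false
namespace FC
namespace Red
variable {k : ℕ} {P : MvPolynomial (Fin 3) ℝ} {v0 v1 v2 : Fin 3 → ℝ}

theorem Psi_ff : Psi (ff P v0 v1 v2) = aeval (fun i => Polynomial.C (Polynomial.C (v2 i : ℂ)) +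
    Polynomial.C (Polynomial.C (v1 i : ℂ) + Polynomial.C (v0 i : ℂ) * Polynomial.X) * Polynomial.X) (cx P) := by
  rw [ff, comp_aeval_apply]
  congr 2
  funext i
  simp only [map_add, map_mul, Psi, aeval_X, algHom_C, Polynomial.algebraMap_apply]
  simp
  ring

theorem ff_real : ∃ g : MvPolynomial (Fin 2) ℝ, ff P v0 v1 v2 = MvPolynomial.map (algebraMap ℝ ℂ) g := by
  refine ⟨aeval (fun i => C (v2 i) + C (v0 i) * X 0 + C (v1 i) * X 1) P, ?_⟩
  rw [ff, cx]
  induction P using MvPolynomial.induction_on with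
  | C a => simp
  | add p q hp hq => simp only [map_add, hp, hq]
  | mul_X p i hp =>
    simp only [map_mul, map_add, hp, aeval_X, map_X, map_C]
    rfl

theorem pt_real (x y : ℝ) : pt v0 v1 v2 ![(x : ℂ), (y : ℂ)] =
    fun i => ((v2 i + v0 i * x + v1 i * y : ℝ) : ℂ) := by
  funext i
  simp [pt]

theorem natDegree_phi (R : Red k P v0 v1 v2) :
    (aeval (fun i => Polynomial.C (v1 i : ℂ) + Polynomial.C (v0 i : ℂ) * Polynomial.X) (cx P) :
        Polynomial ℂ).natDegree = 2 * k := by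
  obtain ⟨h1, h2⟩ := hom_sub (S := ℂ) (cx P) (2 * k) R.homc (fun i => (v1 i : ℂ)) (fun i => (v0 i : ℂ))
  refine le_antisymm h1 (Polynomial.le_natDegree_of_ne_zero ?_)
  rw [h2, aeval_eq_eval]
  have := eval_map_real P v0
  rw [show (algebraMap ℝ ℂ) = Complex.ofRealHom from rfl] at *
  erw [this]
  exact_mod_cast R.P0

theorem toDat (R : Red k P v0 v1 v2) : Dat k (2 * k - 2) (ff P v0 v1 v2) := by
  have hk := R.hk
  obtain ⟨h1, h2⟩ := hom_sub (S := Polynomial ℂ) (cx P) (2 * k) R.homc (fun i => Polynomial.C (v2 i : ℂ))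
    (fun i => Polynomial.C (v1 i : ℂ) + Polynomial.C (v0 i : ℂ) * Polynomial.X)
  rw [← Psi_ff] at h1 h2
  have e : 2 * k - 2 + 2 = 2 * k := by omega
  have hT : T (2 * k - 2 + 2) (ff P v0 v1 v2) = aeval (fun i => Polynomial.C (v1 i : ℂ) + Polynomial.C (v0 i : ℂ) * Polynomial.X) (cx P) := by
    rw [e, T_apply, h2]
  refine ⟨by omega, ?_, ?_, ?_, ?_, ?_, ?_, ?_⟩
  · rw [mem_RL_succ, e]; exact h1
  · rw [hT, e]; exact R.natDegree_phi
  · rw [hT]; exact R.sep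
  · intro x hx
    rw [hT, peval_aeval] at hx
    have h3 : (fun i => (Polynomial.C (v1 i : ℂ) + Polynomial.C (v0 i : ℂ) * Polynomial.X).eval (x : ℂ)) =
        fun i => ((x * v0 i + 1 * v1 i : ℝ) : ℂ) := by
      funext i; simp; ring
    rw [h3, eval_map_real] at hx
    have := (R.inf x 1 (by exact_mod_cast hx)).2
    exact one_ne_zero this
  · obtain ⟨g, hg⟩ := ff_real (P := P) (v0 := v0) (v1 := v1) (v2 := v2)
    rw [hg, sg]
    rw [MvPolynomial.map_map]
    congr 1
    congr 1
    ext x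
    simp
  · intro x
    refine ⟨_, R.sgn (x 0) (x 1), ?_⟩
    rw [eval_ff, ← eval_map_real, ← pt_real]
    congr 2
  · intro q a b c
    exact R.jac q ⟨a, b, c⟩

/-- partials vanish at real zeros -/
theorem grad_zero (R : Red k P v0 v1 v2) (x y : ℝ)
    (h : eval (fun i => v2 i + v0 i * x + v1 i * y) P = 0) (w : Fin 3 → ℝ)
    (hw : ∀ t : ℝ, 0 ≤ eval (fun i => (v2 i + v0 i * x + v1 i * y) + w i * t) P) :
    ∑ i, eval (fun i => v2 i + v0 i * x + v1 i * y) (pderiv i P) * w i = 0 := by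
  set a : Fin 3 → ℝ := fun i => v2 i + v0 i * x + v1 i * y with ha
  let p : Polynomial ℝ := aeval (fun i => Polynomial.C (a i) + Polynomial.C (w i) * Polynomial.X) P
  have hp : ∀ t, p.eval t = eval (fun i => a i + w i * t) P := by
    intro t
    simp only [p, peval_aeval]
    congr 2
    funext i; simp
  have hd : p.derivative.eval 0 = ∑ i, eval a (pderiv i P) * w i := by
    have := chain (Polynomial.derivative' (R := ℝ)) (fun i => Polynomial.C (a i) + Polynomial.C (w i) * Polynomial.X) P
    have h2 : p.derivative = ∑ i, aeval (fun i => Polynomial.C (a i) + Polynomial.C (w i) * Polynomial.X) (pderiv i P) * Polynomial.C (w i) := by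
      refine Eq.trans this (Finset.sum_congr rfl fun i _ => ?_)
      congr 1
      simp [Polynomial.derivative'_apply]
    rw [h2, Polynomial.eval_finsetSum]
    refine Finset.sum_congr rfl fun i _ => ?_
    rw [Polynomial.eval_mul, Polynomial.eval_C, peval_aeval]
    simp
  rw [← hd]
  refine IsLocalMin.hasDerivAt_eq_zero ?_ (p.hasDerivAt 0)
  refine Filter.Eventually.of_forall fun t => ?_
  have h0 : p.eval 0 = 0 := by rw [hp]; simpa using h
  change p.eval 0 ≤ p.eval t
  rw [h0, hp]
  exact hw t

theorem real_nod (R : Red k P v0 v1 v2) (x y : ℝ)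
    (h : eval (fun i => v2 i + v0 i * x + v1 i * y) P = 0) :
    ![(x : ℂ), (y : ℂ)] ∈ Nod (ff P v0 v1 v2) := by
  have hc : ∀ g : MvPolynomial (Fin 3) ℝ, eval (pt v0 v1 v2 ![(x : ℂ), (y : ℂ)]) (cx g) =
      ((eval (fun i => v2 i + v0 i * x + v1 i * y) g : ℝ) : ℂ) := by
    intro g
    rw [pt_real, eval_map_real]
  have h0 := R.grad_zero x y h v0 (fun t => by
    have := R.sgn (x + t) y
    convert this using 4
    ring)
  have h1 := R.grad_zero x y h v1 (fun t => by
    have := R.sgn x (y + t)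
    convert this using 4
    ring)
  refine ⟨?_, ?_, ?_⟩
  · rw [eval_ff, hc, h]; rfl
  · rw [ff, pd0]
    simp only [map_sum, map_mul, ev, eval_C, pderiv_map, hc]
    exact_mod_cast h0
  · rw [ff, pd1]
    simp only [map_sum, map_mul, ev, eval_C, pderiv_map, hc]
    exact_mod_cast h1

theorem real_count (R : Red k P v0 v1 v2) (hf : (Nod (ff P v0 v1 v2)).Finite) :
    (RZ P).ncard ≤ {q ∈ Nod (ff P v0 v1 v2) | cj q = q}.ncard := by
  have h1 : ∀ p : Projectivization ℝ (Fin 3 → ℝ), p ∈ RZ P → ∃ x y c : ℝ, c ≠ 0 ∧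
      ∀ i, p.rep i = c * (v2 i + v0 i * x + v1 i * y) := by
    intro p hp
    obtain ⟨a, b, c, h⟩ := coords _ _ _ R.det p.rep
    have hc : c ≠ 0 := by
      rintro rfl
      have hz : p.rep = fun i => a * v0 i + b * v1 i := by
        funext i; rw [h]; ring
      have h0 : eval p.rep P = 0 := hp
      rw [hz] at h0
      obtain ⟨rfl, rfl⟩ := R.inf a b h0
      apply p.rep_nonzero
      rw [hz]; funext i; simp
    refine ⟨a / c, b / c, c, hc, fun i => ?_⟩
    rw [h]; field_simp; ring
  choose! x y c hc hrep using h1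
  refine Set.ncard_le_ncard_of_injOn (fun p => ![(x p : ℂ), (y p : ℂ)]) ?_ ?_ (hf.subset (Set.sep_subset _ _))
  · intro p hp
    refine ⟨R.real_nod _ _ ?_, ?_⟩
    · have h0 : eval p.rep P = 0 := hp
      rw [show p.rep = fun i => c p * (v2 i + v0 i * x p + v1 i * y p) from funext (hrep p hp),
        eval_scale P R.hom] at h0
      exact (mul_eq_zero.1 h0).resolve_left (pow_ne_zero _ (hc p hp))
    · funext i
      fin_cases i <;> simp [cj]
  · intro p hp q hq hpq
    have hx : x p = x q := by simpa using congrFun hpq 0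
    have hy : y p = y q := by simpa using congrFun hpq 1
    rw [← p.mk_rep, ← q.mk_rep, Projectivization.mk_eq_mk_iff']
    refine ⟨c p / c q, ?_⟩
    funext i
    rw [Pi.smul_apply, hrep p hp, hrep q hq, hx, hy, smul_eq_mul]
    have := hc q hq
    field_simp

theorem sing_count (R : Red k P v0 v1 v2) (hf : (Nod (ff P v0 v1 v2)).Finite) :
    (SingSet (cx P)).ncard ≤ (Nod (ff P v0 v1 v2)).ncard := by
  have hk := R.hk
  have h1 : ∀ p : Projectivization ℂ (Fin 3 → ℂ), p ∈ SingSet (cx P) → ∃ q : Fin 2 → ℂ, ∃ c : ℂ, c ≠ 0 ∧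
      ∀ i, p.rep i = c * pt v0 v1 v2 q i := by
    intro p hp
    obtain ⟨a, b, c, h⟩ := coords _ _ _ R.det_c p.rep
    have hg : ∀ i, eval p.rep (pderiv i (cx P)) = 0 := hp
    have hQ : eval p.rep (cx P) = 0 := by
      have he := euler (cx P) R.homc p.rep
      simp only [hg, mul_zero, Finset.sum_const_zero] at he
      refine (mul_eq_zero.1 he.symm).resolve_left ?_
      have : 2 * k ≠ 0 := by omega
      exact_mod_cast this
    have hc : c ≠ 0 := by
      rintro rfl
      by_cases hb : b = 0
      · have hz : p.rep = fun i => a * (v0 i : ℂ) := by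
          funext i; rw [h, hb]; ring
        have ha : a ≠ 0 := by
          rintro rfl
          apply p.rep_nonzero
          rw [hz]; funext i; simp
        rw [hz, eval_scale _ R.homc, eval_map_real] at hQ
        have := (mul_eq_zero.1 hQ).resolve_left (pow_ne_zero _ ha)
        exact R.P0 (by exact_mod_cast this)
      · have hz : p.rep = fun i => b * ((v1 i : ℂ) + (v0 i : ℂ) * (a / b)) := by
          funext i; rw [h]; field_simp; ring
        rw [hz, eval_scale _ R.homc] at hQ
        have hQ' := (mul_eq_zero.1 hQ).resolve_left (pow_ne_zero _ hb)
        have hg' : ∀ i, eval (fun i => (v1 i : ℂ) + (v0 i : ℂ) * (a / b)) (pderiv i (cx P)) = 0 := by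
          intro i
          have := hg i
          rw [hz, eval_scale _ R.homc.pderiv] at this
          exact (mul_eq_zero.1 this).resolve_left (pow_ne_zero _ hb)
        obtain ⟨u, v, huv⟩ := R.sep
        have e1 := congrArg (Polynomial.eval (a / b)) huv
        rw [Polynomial.eval_add, Polynomial.eval_mul, Polynomial.eval_mul, peval_aeval] at e1
        have e2 := chain (Polynomial.derivative' (R := ℂ)) (fun i => Polynomial.C (v1 i : ℂ) + Polynomial.C (v0 i : ℂ) * Polynomial.X) (cx P)
        rw [Polynomial.derivative'_apply] at e2
        rw [e2, Polynomial.eval_finsetSum] at e1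
        simp only [Polynomial.eval_mul, peval_aeval, Polynomial.eval_add, Polynomial.eval_C, Polynomial.eval_X,
          hg', hQ', zero_mul, mul_zero, Finset.sum_const_zero, add_zero, Polynomial.eval_one] at e1
        exact zero_ne_one e1
    refine ⟨![a / c, b / c], c, hc, fun i => ?_⟩
    rw [h]; simp only [pt, Matrix.cons_val_zero, Matrix.cons_val_one]; field_simp; ring
  choose! q c hc hrep using h1
  refine Set.ncard_le_ncard_of_injOn q ?_ ?_ hf
  · intro p hp
    rw [R.nod_iff]
    intro i
    have h0 : eval p.rep (pderiv i (cx P)) = 0 := hp i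
    rw [show p.rep = fun i => c p * pt v0 v1 v2 (q p) i from funext (hrep p hp),
        eval_scale _ R.homc.pderiv] at h0
    exact (mul_eq_zero.1 h0).resolve_left (pow_ne_zero _ (hc p hp))
  · intro p hp p' hp' hpq
    rw [← p.mk_rep, ← p'.mk_rep, Projectivization.mk_eq_mk_iff']
    refine ⟨c p / c p', ?_⟩
    funext i
    rw [Pi.smul_apply, hrep p hp, hrep p' hp', hpq, smul_eq_mul]
    have := hc p' hp'
    field_simp

theorem bound (R : Red k P v0 v1 v2) : (RZ P).ncard + (SingSet (cx P)).ncard ≤ 3 * k ^ 2 - 3 * k + 2 := by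
  obtain ⟨hf, h⟩ := R.toDat.core
  have h1 := R.real_count hf
  have h2 := R.sing_count hf
  omega

end Red
end FC

end


section
namespace FC

theorem sign_const (P : MvPolynomial (Fin 3) ℝ) {d : ℕ} (hom : P.IsHomogeneous d) (hfin : (RZ P).Finite)
    (v0 v1 v2 : Fin 3 → ℝ) (hdet : det3 v0 v1 v2 ≠ 0) :
    (∀ x y : ℝ, 0 ≤ eval (fun i => v2 i + v0 i * x + v1 i * y) P) ∨
    (∀ x y : ℝ, eval (fun i => v2 i + v0 i * x + v1 i * y) P ≤ 0) := by
  let h : (Fin 2 → ℝ) → ℝ := fun x => eval (fun i => v2 i + v0 i * x 0 + v1 i * x 1) P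
  have hcont : Continuous h := by
    have h1 : Continuous (fun z : Fin 3 → ℝ => eval z P) := MvPolynomial.continuous_eval P
    refine h1.comp ?_
    fun_prop
  have hne : ∀ x : Fin 2 → ℝ, (fun i => v2 i + v0 i * x 0 + v1 i * x 1) ≠ 0 := by
    intro x hx
    have := (indep _ _ _ hdet (x 0) (x 1) 1 (fun i => by
      have := congrFun hx i
      simp only [Pi.zero_apply] at this
      linear_combination this)).2.2
    exact one_ne_zero this
  have hZ : {x | h x = 0}.Finite := by
    refine Set.Finite.of_injOn (f := fun x => Projectivization.mk ℝ _ (hne x)) (t := RZ P) ?_ ?_ hfin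
    · intro x hx
      obtain ⟨a, ha⟩ := Projectivization.exists_smul_eq_mk_rep ℝ _ (hne x)
      change eval (Projectivization.mk ℝ _ (hne x)).rep P = 0
      rw [← ha]
      have := eval_scale P hom (a : ℝ) (fun i => v2 i + v0 i * x 0 + v1 i * x 1)
      have hx' : eval (fun i => v2 i + v0 i * x 0 + v1 i * x 1) P = 0 := hx
      rw [hx', mul_zero] at this
      exact this
    · intro x hx y hy hxy
      obtain ⟨a, ha⟩ := (Projectivization.mk_eq_mk_iff' ℝ _ _ (hne x) (hne y)).1 hxy
      obtain ⟨e0, e1, e2⟩ := indep _ _ _ hdet (a * y 0 - x 0) (a * y 1 - x 1) (a - 1) (fun i => by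
        have := congrFun ha i
        simp only [Pi.smul_apply, smul_eq_mul] at this
        linear_combination this)
      have ha1 : a = 1 := by linarith
      subst ha1
      funext i
      fin_cases i
      · simp only [Fin.zero_eta]; linarith
      · simp only [Fin.mk_one]; linarith
  by_contra hcon
  push Not at hcon
  obtain ⟨⟨x0, y0, hneg⟩, ⟨x1, y1, hpos⟩⟩ := hcon
  have hrank : 1 < Module.rank ℝ (Fin 2 → ℝ) := by
    rw [rank_fin_fun]; norm_num
  have hpc := (hZ.countable.isPathConnected_compl_of_one_lt_rank hrank).isConnected.isPreconnected
  have hneg' : h ![x0, y0] < 0 := by simpa [h] using hneg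
  have hpos' : 0 < h ![x1, y1] := by simpa [h] using hpos
  have := hpc.intermediate_value (a := ![x0, y0]) (b := ![x1, y1]) (f := h)
    hneg'.ne hpos'.ne' hcont.continuousOn ⟨hneg'.le, hpos'.le⟩
  obtain ⟨z, hz, hz0⟩ := this
  exact hz hz0

/-- linear form -/
noncomputable def lin (w : Fin 3 → ℝ) : MvPolynomial (Fin 3) ℂ := ∑ i, C (w i : ℂ) * X i

theorem eval_lin (w : Fin 3 → ℝ) (z : Fin 3 → ℝ) :
    eval (fun i => (z i : ℂ)) (lin w) = ((∑ i, w i * z i : ℝ) : ℂ) := by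
  simp [lin]

theorem lin_ne (w : Fin 3 → ℝ) (h : w ≠ 0) : lin w ≠ 0 := by
  intro h0
  have h1 := eval_lin w w
  rw [h0, map_zero] at h1
  have h2 : ∑ i, w i * w i = 0 := by exact_mod_cast h1.symm
  rw [Fin.sum_univ_three] at h2
  apply h
  have a0 : w 0 = 0 := by nlinarith [mul_self_nonneg (w 0), mul_self_nonneg (w 1), mul_self_nonneg (w 2)]
  have a1 : w 1 = 0 := by nlinarith [mul_self_nonneg (w 0), mul_self_nonneg (w 1), mul_self_nonneg (w 2)]
  have a2 : w 2 = 0 := by nlinarith [mul_self_nonneg (w 0), mul_self_nonneg (w 1), mul_self_nonneg (w 2)]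
  funext i
  fin_cases i <;> simp [a0, a1, a2]

def crs (a b : Fin 3 → ℝ) : Fin 3 → ℝ :=
  ![a 1 * b 2 - a 2 * b 1, a 2 * b 0 - a 0 * b 2, a 0 * b 1 - a 1 * b 0]

theorem crs_dot (a b c : Fin 3 → ℝ) : ∑ i, crs a b i * c i = det3 a b c := by
  simp [Fin.sum_univ_three, crs, det3]; ring

/-- vanishing cross product means proportional -/
theorem crs_zero (a b : Fin 3 → ℝ) (h : crs a b = 0) (hb : b ≠ 0) : ∃ c : ℝ, ∀ i, a i = c * b i := by
  have h0 : a 1 * b 2 - a 2 * b 1 = 0 := congrFun h 0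
  have h1 : a 2 * b 0 - a 0 * b 2 = 0 := congrFun h 1
  have h2 : a 0 * b 1 - a 1 * b 0 = 0 := congrFun h 2
  obtain ⟨j, hj⟩ := Function.ne_iff.1 hb
  have hj' : b j ≠ 0 := hj
  refine ⟨a j / b j, fun i => ?_⟩
  rw [div_mul_eq_mul_div, eq_div_iff hj']
  fin_cases j <;> fin_cases i <;> simp <;> linarith

theorem exists_red (k : ℕ) (hk : 1 ≤ k) (P : MvPolynomial (Fin 3) ℝ) (hP : P ≠ 0)
    (hhom : P.IsHomogeneous (2 * k)) (hsf : Squarefree (cx P)) (hfin : (RZ P).Finite) :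
    ∃ v0 v1 v2 : Fin 3 → ℝ, det3 v0 v1 v2 ≠ 0 ∧ eval v0 P ≠ 0 ∧
      (aeval (fun i => Polynomial.C (v1 i : ℂ) + Polynomial.C (v0 i : ℂ) * Polynomial.X) (cx P) :
        Polynomial ℂ).Separable ∧
      ∀ α β : ℝ, eval (fun i => α * v0 i + β * v1 i) P = 0 → α = 0 ∧ β = 0 := by
  classical
  obtain ⟨v0, h0⟩ : ∃ v0, eval v0 P ≠ 0 := by
    by_contra hc
    push Not at hc
    exact hP (MvPolynomial.funext fun x => by rw [hc, map_zero])
  have hv0 : v0 ≠ 0 := by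
    rintro rfl
    apply h0
    have := eval_scale P hhom 0 0
    rw [zero_pow (by omega), zero_mul] at this
    rw [← this]
    congr 2
    funext i; simp
  obtain ⟨D, hD, hsep⟩ := generic_sep (cx P) (2 * k) (hhom.map _) hsf (fun i => (v0 i : ℂ))
    (by rw [eval_map_real]; exact_mod_cast h0)
  obtain ⟨w0, hw0, hw0v⟩ : ∃ w0 : Fin 3 → ℝ, w0 ≠ 0 ∧ ∑ i, w0 i * v0 i = 0 := by
    by_cases hz : v0 0 = 0 ∧ v0 1 = 0
    · refine ⟨![1, 0, 0], fun h => one_ne_zero (congrFun h 0), ?_⟩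
      simp [Fin.sum_univ_three, hz.1]
    · refine ⟨![v0 1, -v0 0, 0], fun h => ?_, ?_⟩
      · exact hz ⟨neg_eq_zero.1 (congrFun h 1), congrFun h 0⟩
      · simp [Fin.sum_univ_three]; ring
  have hcr : ∀ p ∈ hfin.toFinset, lin (crs p.rep v0) ≠ 0 := by
    intro p hp
    apply lin_ne
    intro hc
    obtain ⟨c, hc⟩ := crs_zero _ _ hc hv0
    have hp0 : eval p.rep P = 0 := hfin.mem_toFinset.1 hp
    rw [show p.rep = fun i => c * v0 i from funext hc, eval_scale P hhom] at hp0
    have hc0 : c ≠ 0 := by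
      rintro rfl
      apply p.rep_nonzero
      funext i; rw [hc]; simp
    exact h0 ((mul_eq_zero.1 hp0).resolve_left (pow_ne_zero _ hc0))
  have hG : D * lin w0 * ∏ p ∈ hfin.toFinset, lin (crs p.rep v0) ≠ 0 :=
    mul_ne_zero (mul_ne_zero hD (lin_ne _ hw0)) (Finset.prod_ne_zero_iff.2 hcr)
  obtain ⟨v1, hv1⟩ : ∃ v1 : Fin 3 → ℝ, eval (fun i => (v1 i : ℂ))
      (D * lin w0 * ∏ p ∈ hfin.toFinset, lin (crs p.rep v0)) ≠ 0 := by
    by_contra hc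
    push Not at hc
    apply hG
    refine MvPolynomial.funext_set (fun _ => Set.range (fun x : ℝ => (x : ℂ)))
      (fun _ => Set.infinite_range_of_injective Complex.ofReal_injective) fun x hx => ?_
    have : ∀ i, ∃ y : ℝ, (y : ℂ) = x i := fun i => hx i trivial
    choose y hy using this
    rw [map_zero, ← hc y]
    congr 2
    funext i; exact (hy i).symm
  rw [map_mul, map_mul, map_prod] at hv1
  have hA := left_ne_zero_of_mul (left_ne_zero_of_mul hv1)
  have hB := right_ne_zero_of_mul (left_ne_zero_of_mul hv1)
  have hC := right_ne_zero_of_mul hv1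
  rw [Finset.prod_ne_zero_iff] at hC
  rw [eval_lin] at hB
  have hB' : ∑ i, w0 i * v1 i ≠ 0 := by exact_mod_cast hB
  rw [Fin.sum_univ_three] at hB' hw0v
  have hlin : ∀ α β : ℝ, (∀ i, α * v0 i + β * v1 i = 0) → α = 0 ∧ β = 0 := by
    intro α β h
    have hβ : β = 0 := by
      refine (mul_eq_zero.1 (?_ : β * (w0 0 * v1 0 + w0 1 * v1 1 + w0 2 * v1 2) = 0)).resolve_right hB'
      linear_combination w0 0 * h 0 + w0 1 * h 1 + w0 2 * h 2 - α * hw0v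
    refine ⟨?_, hβ⟩
    by_contra hα
    apply hv0
    funext i
    have := h i
    rw [hβ, zero_mul, add_zero] at this
    exact (mul_eq_zero.1 this).resolve_left hα
  refine ⟨v0, v1, crs v0 v1, ?_, h0, hsep _ hA, ?_⟩
  · rw [← crs_dot]
    intro h
    have hne : crs v0 v1 ≠ 0 := by
      intro hc
      have hv1ne : v1 ≠ 0 := by
        rintro rfl
        exact hB' (by simp)
      obtain ⟨c, hc⟩ := crs_zero _ _ hc hv1ne
      exact one_ne_zero (hlin 1 (-c) fun i => by rw [hc]; ring).1
    have h1 := eval_lin (crs v0 v1) (crs v0 v1)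
    rw [Fin.sum_univ_three] at h
    apply hne
    set w := crs v0 v1
    have a0 : w 0 = 0 := by nlinarith [mul_self_nonneg (w 0), mul_self_nonneg (w 1), mul_self_nonneg (w 2)]
    have a1 : w 1 = 0 := by nlinarith [mul_self_nonneg (w 0), mul_self_nonneg (w 1), mul_self_nonneg (w 2)]
    have a2 : w 2 = 0 := by nlinarith [mul_self_nonneg (w 0), mul_self_nonneg (w 1), mul_self_nonneg (w 2)]
    funext i
    fin_cases i <;> simp [a0, a1, a2]
  · intro α β h
    by_cases hz : (fun i => α * v0 i + β * v1 i) = 0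
    · exact hlin α β fun i => congrFun hz i
    · exfalso
      obtain ⟨a, ha⟩ := Projectivization.exists_smul_eq_mk_rep ℝ _ hz
      have hrep : (Projectivization.mk ℝ _ hz).rep = fun i => (a : ℝ) * (α * v0 i + β * v1 i) := by
        rw [← ha]; rfl
      have hmem : Projectivization.mk ℝ _ hz ∈ RZ P := by
        change eval (Projectivization.mk ℝ _ hz).rep P = 0
        rw [hrep, eval_scale P hhom, h, mul_zero]
      have := hC _ (hfin.mem_toFinset.2 hmem)
      rw [eval_lin, crs_dot, hrep] at this
      apply this
      norm_cast
      simp only [det3]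
      ring

theorem final (k : ℕ) (hk : 1 ≤ k) (P : MvPolynomial (Fin 3) ℝ) (hP : P ≠ 0)
    (hhom : P.IsHomogeneous (2 * k)) (hsf : Squarefree (cx P))
    (hnodal : ∀ x ∈ SingSet (cx P), IsNodeAt (cx P) x) (hfin : (RZ P).Finite) :
    (RZ P).ncard + (SingSet (cx P)).ncard ≤ 3 * k ^ 2 - 3 * k + 2 := by
  obtain ⟨v0, v1, v2, hdet, h0, hsep, hinf⟩ := exists_red k hk P hP hhom hsf hfin
  have hK := knode_of_rank _ _ (hhom.map _) hnodal
  rcases sign_const P hhom hfin v0 v1 v2 hdet with hs | hs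
  · exact Red.bound (v0 := v0) (v1 := v1) (v2 := v2) ⟨hk, hhom, hdet, h0, hsep, hinf, hs, hK⟩
  · have hcx : cx (-P) = -cx P := by simp [cx]
    have e1 : RZ (-P) = RZ P := by ext x; simp [RZ]
    have e2 : SingSet (cx (-P)) = SingSet (cx P) := by ext x; simp [SingSet]
    rw [← e1, ← e2]
    refine Red.bound (v0 := v0) (v1 := v1) (v2 := v2) ⟨hk, ?_, hdet, ?_, ?_, ?_, ?_, ?_⟩
    · exact (mem_homogeneousSubmodule _ _).1 ((homogeneousSubmodule (Fin 3) ℝ (2 * k)).neg_mem hhom)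
    · simpa using h0
    · rw [hcx, map_neg]
      obtain ⟨a, b, hab⟩ := hsep
      refine ⟨-a, -b, ?_⟩
      rw [Polynomial.derivative_neg]
      linear_combination hab
    · intro α β h
      exact hinf α β (by simpa using h)
    · intro x y
      have := hs x y
      simpa using this
    · rw [hcx]
      intro z hz hg u hu
      refine hK z hz (fun i => by simpa using hg i) u (fun i => ?_)
      have := hu i
      simpa using this

end FC

end

theorem stmt_1 (k δ : ℕ) (hk : 1 ≤ k) (P : MvPolynomial (Fin 3) ℝ) (hP : P ≠ 0)
    (hhom : P.IsHomogeneous (2 * k))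
    (hsf : Squarefree (MvPolynomial.map (algebraMap ℝ ℂ) P))
    (hnodal : ∀ x ∈ SingSet (MvPolynomial.map (algebraMap ℝ ℂ) P),
      IsNodeAt (MvPolynomial.map (algebraMap ℝ ℂ) P) x)
    (hδ : (SingSet (MvPolynomial.map (algebraMap ℝ ℂ) P)).ncard = δ)
    (hfin : (RZ P).Finite) :
    ((RZ P).ncard : ℤ) ≤ (k : ℤ) ^ 2 + ((2 * (k : ℤ) - 1) * ((k : ℤ) - 1) - (δ : ℤ)) + 1 := by
  have h := FC.final k hk P hP hhom hsf hnodal hfin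
  have e : (SingSet (FC.cx P)).ncard = δ := hδ
  rw [e] at h
  have h2 : 3 * k ≤ 3 * k ^ 2 := by nlinarith
  have h3 : (RZ P).ncard + δ + 3 * k ≤ 3 * k ^ 2 + 2 := by omega
  have h4 : ((RZ P).ncard : ℤ) + δ + 3 * k ≤ 3 * (k : ℤ) ^ 2 + 2 := by exact_mod_cast h3
  linarith [h4]
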